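/- Let 0 < β ≤ α < 1 and let φ : [2,∞) → (0,∞) be nondecreasing with lim_{t→∞} φ(t) = ∞ and with φ(2t) ≤ φ(t) + C₀ for all t ≥ 2 and some constant C₀. Then there exist a compact set E ⊂ ℝ, a Borel probability measure μ on ℝ with μ(E) = 1, a sequence of sets F_l ⊂ ℝ (l ≥ 1), each a finite union of intervals with μ(F_l) > 0, and constants 0 < c ≤ C < ∞ such that: (i) |μ̂(ξ)| ≤ C·|ξ|^{−β/2} for all ξ ≠ 0; (ii) for every x ∈ E and r ∈ (0,1/4), c·(2r)^α / (φ(1/(2r))·log(1/(2r))) ≤ μ([x−r, x+r]) ≤ C·(2r)^α / log(1/(2r)); and (iii) for every q with 2 ≤ q < 2 + 4(1−α)/β, the quantities ‖(1_{F_l} dμ)^∧‖_{L^q(ℝ)} / ‖1_{F_l}‖_{L²(μ)} are unbounded in l, i.e. sup_{l ≥ 1} ‖(1_{F_l} dμ)^∧‖_{L^q(ℝ)} / ‖1_{F_l}‖_{L²(μ)} = ∞. -/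

import Mathlib

open MeasureTheory Filter


/-- The trigonometric character. -/
noncomputable def ech (θ : ℝ) : ℂ := Complex.exp (-(2 * (Real.pi : ℂ) * Complex.I * (θ : ℂ)))

lemma ech_eq (θ : ℝ) : ech θ = Complex.exp (Complex.I * ((-(2 * Real.pi * θ) : ℝ) : ℂ)) := by
  unfold ech; congr 1; push_cast; ring

lemma norm_ech (θ : ℝ) : ‖ech θ‖ = 1 := by
  rw [ech_eq, mul_comm, Complex.norm_exp_ofReal_mul_I]

lemma ech_add (x y : ℝ) : ech (x + y) = ech x * ech y := by
  unfold ech; rw [← Complex.exp_add]; congr 1; push_cast; ring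

lemma ech_zero : ech 0 = 1 := by simp [ech]

lemma norm_ech_sub_one_le (x : ℝ) : ‖ech x - 1‖ ≤ 2 * Real.pi * |x| := by
  rw [ech_eq]
  refine (Real.norm_exp_I_mul_ofReal_sub_one_le).trans ?_
  rw [Real.norm_eq_abs, abs_neg, abs_mul, abs_of_pos (by positivity)]

lemma norm_ech_sub_le (x y : ℝ) : ‖ech x - ech y‖ ≤ 2 * Real.pi * |x - y| := by
  have h : ech x - ech y = ech y * (ech (x - y) - 1) := by
    rw [mul_sub, ← ech_add]; simp
  rw [h, norm_mul, norm_ech, one_mul]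
  exact norm_ech_sub_one_le _

lemma ech_nat (k : ℕ) : ech k = 1 := by
  unfold ech
  rw [Complex.exp_eq_one_iff]
  exact ⟨-k, by push_cast; ring⟩

lemma ech_int (k : ℤ) : ech k = 1 := by
  unfold ech
  rw [Complex.exp_eq_one_iff]
  exact ⟨-k, by push_cast; ring⟩

lemma continuous_ech : Continuous ech := by
  unfold ech; fun_prop

/-- Choosing signs greedily, keeping an exponential potential under control. -/
lemma signs_potential {ι : Type*} (J : Finset ι) (lam : ℝ) (S : Finset ℕ) (v : ι → ℕ → ℝ)
    (hv : ∀ i m, |v i m| ≤ 1) :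
    ∃ σ : ℕ → ℝ, (∀ m, σ m = 1 ∨ σ m = -1) ∧
      ∑ i ∈ J, Real.cosh (lam * ∑ m ∈ S, σ m * v i m) ≤
        J.card * Real.exp (lam ^ 2 / 2) ^ S.card := by
  classical
  induction S using Finset.induction_on with
  | empty => exact ⟨fun _ => 1, fun _ => Or.inl rfl, by simp⟩
  | insert x S hx ih =>
    obtain ⟨σ, hσ, hle⟩ := ih
    have key : ∀ t : ℝ, (∑ i ∈ J, Real.cosh (lam * ∑ m ∈ insert x S,
        Function.update σ x t m * v i m)) =
        ∑ i ∈ J, Real.cosh (lam * ∑ m ∈ S, σ m * v i m + lam * (t * v i x)) := by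
      intro t
      refine Finset.sum_congr rfl fun i _ => ?_
      rw [Finset.sum_insert hx]
      congr 1
      have : ∑ m ∈ S, Function.update σ x t m * v i m = ∑ m ∈ S, σ m * v i m := by
        refine Finset.sum_congr rfl fun m hm => ?_
        rw [Function.update_of_ne (by rintro rfl; exact hx hm)]
      rw [this]; simp; ring
    have avg : (∑ i ∈ J, Real.cosh (lam * ∑ m ∈ S, σ m * v i m + lam * (1 * v i x))) +
        (∑ i ∈ J, Real.cosh (lam * ∑ m ∈ S, σ m * v i m + lam * ((-1) * v i x))) ≤
        2 * (J.card * Real.exp (lam ^ 2 / 2) ^ (insert x S).card) := by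
      rw [← Finset.sum_add_distrib, Finset.card_insert_of_notMem hx, pow_succ]
      calc _ ≤ ∑ i ∈ J, 2 * Real.exp (lam ^ 2 / 2) * Real.cosh (lam * ∑ m ∈ S, σ m * v i m) := by
            refine Finset.sum_le_sum fun i _ => ?_
            have h1 : lam * ((-1) * v i x) = - (lam * v i x) := by ring
            rw [h1, one_mul, Real.cosh_add, Real.cosh_add, Real.cosh_neg, Real.sinh_neg]
            have h2 : Real.cosh (lam * v i x) ≤ Real.exp (lam ^ 2 / 2) := by
              refine (Real.cosh_le_exp_half_sq _).trans (Real.exp_le_exp.2 ?_)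
              rw [mul_pow]
              have : v i x ^ 2 ≤ 1 := by rw [sq_le_one_iff_abs_le_one]; exact hv i x
              nlinarith [sq_nonneg lam]
            have h3 : 0 < Real.cosh (lam * ∑ m ∈ S, σ m * v i m) := Real.cosh_pos _
            nlinarith
        _ ≤ _ := by
            rw [← Finset.mul_sum]
            have : 0 < Real.exp (lam ^ 2 / 2) := Real.exp_pos _
            nlinarith
    have hup : ∀ t : ℝ, (t = 1 ∨ t = -1) → ∀ m, Function.update σ x t m = 1 ∨
        Function.update σ x t m = -1 := by
      intro t ht m
      by_cases hm : m = x
      · subst hm; simpa using ht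
      · rw [Function.update_of_ne hm]; exact hσ m
    by_cases hc : (∑ i ∈ J, Real.cosh (lam * ∑ m ∈ S, σ m * v i m + lam * (1 * v i x))) ≤
        J.card * Real.exp (lam ^ 2 / 2) ^ (insert x S).card
    · exact ⟨Function.update σ x 1, hup 1 (Or.inl rfl), by rw [key]; exact hc⟩
    · exact ⟨Function.update σ x (-1), hup (-1) (Or.inr rfl), by rw [key]; linarith⟩

lemma signs (n : ℕ) (S : Finset ℕ) (hS : ∀ m ∈ S, m < 2 ^ n) :
    ∃ σ : ℕ → ℝ, (∀ m, σ m = 1 ∨ σ m = -1) ∧ ∀ θ : ℝ,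
      ‖∑ m ∈ S, (σ m : ℂ) * ech (θ * m)‖ ≤ 20 * Real.sqrt (S.card * (n + 1)) := by
  classical
  rcases S.eq_empty_or_nonempty with rfl | hne
  · exact ⟨fun _ => 1, fun _ => Or.inl rfl, by simp⟩
  have hT : (1 : ℝ) ≤ S.card := by exact_mod_cast hne.card_pos
  set T : ℝ := ((S.card : ℕ) : ℝ) with hTdef
  set N : ℕ := 4 ^ n with hN
  have hNpos : (0 : ℝ) < N := by rw [hN]; positivity
  let J : Finset (ℕ × Bool) := Finset.range N ×ˢ Finset.univ
  let v : ℕ × Bool → ℕ → ℝ := fun i m =>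
    if i.2 then (ech ((i.1 : ℝ) / N * m)).re else (ech ((i.1 : ℝ) / N * m)).im
  have hv : ∀ i m, |v i m| ≤ 1 := by
    intro i m
    simp only [v]
    split_ifs
    · exact (Complex.abs_re_le_norm _).trans (norm_ech _).le
    · exact (Complex.abs_im_le_norm _).trans (norm_ech _).le
  set lam : ℝ := Real.sqrt ((n + 1) / T) with hlam
  have hlam2 : lam ^ 2 = (n + 1) / T := Real.sq_sqrt (by positivity)
  have hlampos : 0 < lam := Real.sqrt_pos.2 (by positivity)
  obtain ⟨σ, hσ, hpot⟩ := signs_potential J lam S v hv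
  set X : ℝ := Real.sqrt (T * (n + 1)) with hX
  have hXl : lam * X = n + 1 := by
    rw [hlam, hX, ← Real.sqrt_mul (by positivity)]
    rw [show ((n : ℝ) + 1) / T * (T * (n + 1)) = (n + 1) * (n + 1) by field_simp]
    exact Real.sqrt_mul_self (by positivity)
  have hX1 : 1 ≤ X := by
    rw [hX]; refine Real.one_le_sqrt.2 ?_
    have : (0 : ℝ) ≤ n := Nat.cast_nonneg n
    nlinarith
  have hbd : ∀ i ∈ J, |∑ m ∈ S, σ m * v i m| ≤ 4 * X := by
    intro i hi
    have h1 : Real.cosh (lam * ∑ m ∈ S, σ m * v i m) ≤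
        J.card * Real.exp (lam ^ 2 / 2) ^ S.card :=
      (Finset.single_le_sum (f := fun i => Real.cosh (lam * ∑ m ∈ S, σ m * v i m))
        (fun i _ => (Real.cosh_pos _).le) hi).trans hpot
    have hJ : (J.card : ℝ) = 4 ^ n * 2 := by simp [J, hN]
    have h2 : Real.exp (lam ^ 2 / 2) ^ S.card = Real.exp ((n + 1) / 2) := by
      rw [← Real.exp_nat_mul, hlam2]
      congr 1
      rw [← hTdef]; field_simp
    have h3 : Real.exp |lam * ∑ m ∈ S, σ m * v i m| ≤
        2 * Real.cosh (lam * ∑ m ∈ S, σ m * v i m) := by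
      rw [← Real.cosh_abs, Real.cosh_eq]
      have := Real.exp_pos (-|lam * ∑ m ∈ S, σ m * v i m|)
      linarith
    have h5 : (4 : ℝ) ≤ Real.exp 2 := by
      have := Real.add_one_le_exp (1 : ℝ)
      have h6 : Real.exp 2 = Real.exp 1 * Real.exp 1 := by rw [← Real.exp_add]; norm_num
      nlinarith
    have h4 : Real.exp |lam * ∑ m ∈ S, σ m * v i m| ≤ Real.exp (4 * (n + 1)) := by
      calc _ ≤ 2 * (4 ^ n * 2 * Real.exp ((n + 1) / 2)) := by rw [← hJ, ← h2]; linarith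
        _ = 4 ^ (n + 1) * Real.exp ((n + 1) / 2) := by ring
        _ ≤ Real.exp 2 ^ (n + 1) * Real.exp ((n + 1) / 2) := by gcongr
        _ = Real.exp (2 * (n + 1) + (n + 1) / 2) := by
            rw [← Real.exp_nat_mul, ← Real.exp_add]; congr 1; push_cast; ring
        _ ≤ _ := Real.exp_le_exp.2 (by linarith [(Nat.cast_nonneg n : (0 : ℝ) ≤ n)])
    have h6 := Real.exp_le_exp.1 h4
    rw [abs_mul, abs_of_pos hlampos] at h6
    have h7 : lam * |∑ m ∈ S, σ m * v i m| ≤ lam * (4 * X) := by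
      rw [show lam * (4 * X) = 4 * (lam * X) by ring, hXl]; exact h6
    exact le_of_mul_le_mul_left h7 hlampos
  have hnet : ∀ k < N, ‖∑ m ∈ S, (σ m : ℂ) * ech ((k : ℝ) / N * m)‖ ≤ 8 * X := by
    intro k hk
    refine (Complex.norm_le_abs_re_add_abs_im _).trans ?_
    have h1 := hbd (k, true) (by simp [J, hk])
    have h2 := hbd (k, false) (by simp [J, hk])
    simp only [v] at h1 h2
    simp only [Complex.re_sum, Complex.im_sum, Complex.re_ofReal_mul, Complex.im_ofReal_mul]
    simp at h1 h2
    linarith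
  refine ⟨σ, hσ, fun θ => ?_⟩
  -- reduce to a net point
  set f : ℝ := Int.fract θ with hf
  have hf0 : 0 ≤ f := Int.fract_nonneg _
  have hf1 : f < 1 := Int.fract_lt_one _
  have hper : ∀ m : ℕ, ech (θ * m) = ech (f * m) := by
    intro m
    have : θ * m = f * m + ((⌊θ⌋ * m : ℤ) : ℝ) := by
      push_cast
      rw [← add_mul, hf, Int.fract_add_floor]
    rw [this, ech_add, ech_int, mul_one]
  set k : ℕ := ⌊f * N⌋₊ with hk
  have hkle : (k : ℝ) ≤ f * N := Nat.floor_le (by positivity)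
  have hklt : f * N < k + 1 := Nat.lt_floor_add_one _
  have hkN : k < N := by
    have : (k : ℝ) < N := by nlinarith
    exact_mod_cast this
  have hd : |f - (k : ℝ) / N| ≤ 1 / N := by
    have e1 : (k : ℝ) / N ≤ f := by rw [div_le_iff₀ hNpos]; exact hkle
    have e2 : f ≤ (k : ℝ) / N + 1 / N := by
      rw [← add_div, le_div_iff₀ hNpos]; exact hklt.le
    rw [abs_of_nonneg (by linarith)]; linarith
  have hScard : T ≤ 2 ^ n := by
    have : S ⊆ Finset.range (2 ^ n) := fun m hm => Finset.mem_range.2 (hS m hm)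
    have := Finset.card_le_card this
    rw [Finset.card_range] at this
    rw [hTdef]; exact_mod_cast this
  have hdiff : ‖∑ m ∈ S, (σ m : ℂ) * ech (θ * m) - ∑ m ∈ S, (σ m : ℂ) * ech ((k : ℝ) / N * m)‖
      ≤ 2 * Real.pi := by
    rw [← Finset.sum_sub_distrib]
    calc _ ≤ ∑ m ∈ S, 2 * Real.pi * ((1 / N) * 2 ^ n) := by
          refine norm_sum_le_of_le _ fun m hm => ?_
          rw [← mul_sub, norm_mul, hper]
          have hs : ‖(σ m : ℂ)‖ = 1 := by
            rcases hσ m with h | h <;> simp [h]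
          rw [hs, one_mul]
          refine (norm_ech_sub_le _ _).trans ?_
          rw [← sub_mul, abs_mul, Nat.abs_cast]
          have : (m : ℝ) ≤ 2 ^ n := by exact_mod_cast (hS m hm).le
          gcongr
      _ = T * (2 * Real.pi * ((1 / N) * 2 ^ n)) := by rw [Finset.sum_const, nsmul_eq_mul]
      _ ≤ 2 ^ n * (2 * Real.pi * ((1 / N) * 2 ^ n)) := by gcongr
      _ = 2 * Real.pi * (2 ^ n * 2 ^ n / N) := by ring
      _ = 2 * Real.pi := by
          rw [hN, ← mul_pow]; norm_num
  have hfin := norm_le_norm_add_norm_sub' (∑ m ∈ S, (σ m : ℂ) * ech (θ * m))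
    (∑ m ∈ S, (σ m : ℂ) * ech ((k : ℝ) / N * m))
  have := hnet k hkN
  have := Real.pi_lt_four
  linarith

/-- start of the block containing `n` -/
def blk (κ : ℕ → ℕ) : ℕ → ℕ
  | 0 => 0
  | n + 1 => if n + 1 < blk κ n + κ (blk κ n) then blk κ n else n + 1

def til (κ τ : ℕ → ℕ) (n : ℕ) : ℕ :=
  min (τ (blk κ n) + (n - blk κ n)) (τ (blk κ n + κ (blk κ n)))

lemma blk_succ (κ : ℕ → ℕ) (n : ℕ) :
    blk κ (n + 1) = if n + 1 < blk κ n + κ (blk κ n) then blk κ n else n + 1 := rfl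

lemma blk_bounds (κ : ℕ → ℕ) (hκ : ∀ n, 1 ≤ κ n) (n : ℕ) :
    blk κ n ≤ n ∧ n < blk κ n + κ (blk κ n) := by
  induction n with
  | zero => exact ⟨le_rfl, by have := hκ (blk κ 0); omega⟩
  | succ n ih =>
    rw [blk_succ]
    split_ifs with h
    · omega
    · have := hκ (n + 1); omega

lemma blk_cases (κ : ℕ → ℕ) (hκ : ∀ n, 1 ≤ κ n) (n : ℕ) :
    (n + 1 < blk κ n + κ (blk κ n) ∧ blk κ (n + 1) = blk κ n) ∨
    (n + 1 = blk κ n + κ (blk κ n) ∧ blk κ (n + 1) = n + 1) := by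
  have h := blk_bounds κ hκ n
  rw [blk_succ]
  split_ifs with h1
  · exact Or.inl ⟨h1, rfl⟩
  · exact Or.inr ⟨by omega, rfl⟩

lemma tau_add (τ : ℕ → ℕ) (hτ : ∀ n, τ n ≤ τ (n + 1) ∧ τ (n + 1) ≤ τ n + 1) (n k : ℕ) :
    τ n ≤ τ (n + k) ∧ τ (n + k) ≤ τ n + k := by
  induction k with
  | zero => simp
  | succ k ih => have := hτ (n + k); rw [← add_assoc]; omega

lemma til_bounds (κ τ : ℕ → ℕ) (hκ : ∀ n, 1 ≤ κ n)
    (hτ : ∀ n, τ n ≤ τ (n + 1) ∧ τ (n + 1) ≤ τ n + 1) (n : ℕ) :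
    τ n ≤ til κ τ n ∧ til κ τ n ≤ τ n + κ (blk κ n) := by
  have h := blk_bounds κ hκ n
  have h1 := tau_add τ hτ (blk κ n) (n - blk κ n)
  have h2 := tau_add τ hτ n (blk κ n + κ (blk κ n) - n)
  rw [show blk κ n + (n - blk κ n) = n by omega] at h1
  rw [show n + (blk κ n + κ (blk κ n) - n) = blk κ n + κ (blk κ n) by omega] at h2
  unfold til
  omega

lemma til_step (κ τ : ℕ → ℕ) (hκ : ∀ n, 1 ≤ κ n)
    (hτ : ∀ n, τ n ≤ τ (n + 1) ∧ τ (n + 1) ≤ τ n + 1) (n : ℕ) :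
    til κ τ (n + 1) = til κ τ n +
      (if n - blk κ n + τ (blk κ n) < τ (blk κ n + κ (blk κ n)) then 1 else 0) := by
  have h := blk_bounds κ hκ n
  have h1 := tau_add τ hτ (blk κ n) (κ (blk κ n))
  unfold til
  rcases blk_cases κ hκ n with ⟨h2, h3⟩ | ⟨h2, h3⟩
  · rw [h3]; split_ifs <;> omega
  · rw [h3, h2, ← h2, Nat.sub_self]
    have h4 := tau_add τ hτ (n + 1) (κ (n + 1))
    rw [← h2] at h1
    split_ifs <;> omega

lemma til_sub (κ τa τb : ℕ → ℕ) (hκ : ∀ n, 1 ≤ κ n)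
    (ha : ∀ n, τa n ≤ τa (n + 1) ∧ τa (n + 1) ≤ τa n + 1)
    (hb : ∀ n, τb n ≤ τb (n + 1) ∧ τb (n + 1) ≤ τb n + 1)
    (hab : ∀ s, τb (s + κ s) + τa s ≤ τa (s + κ s) + τb s) (n : ℕ)
    (h : til κ τb (n + 1) ≠ til κ τb n) : til κ τa (n + 1) = til κ τa n + 1 := by
  rw [til_step κ τb hκ hb] at h
  rw [til_step κ τa hκ ha]
  have := hab (blk κ n)
  split_ifs at h ⊢ <;> omega

lemma til_run (κ τ : ℕ → ℕ) (hκ : ∀ n, 1 ≤ κ n)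
    (hτ : ∀ n, τ n ≤ τ (n + 1) ∧ τ (n + 1) ≤ τ n + 1) (n : ℕ)
    (h1 : til κ τ (n + 1) = til κ τ n) (h2 : til κ τ (n + 1 + 1) ≠ til κ τ (n + 1)) :
    blk κ (n + 1) = n + 1 := by
  rw [til_step κ τ hκ hτ] at h1
  rw [til_step κ τ hκ hτ] at h2
  have h := blk_bounds κ hκ n
  rcases blk_cases κ hκ n with ⟨h3, h4⟩ | ⟨h3, h4⟩
  · rw [h4] at h2
    split_ifs at h1 h2 <;> omega
  · exact h4

lemma blk_count (κ : ℕ → ℕ) (hκ : ∀ n, 1 ≤ κ n) (K s0 : ℕ) (hK : ∀ s, s0 ≤ s → K ≤ κ s) (n : ℕ) :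
    ((Finset.range (n + 1)).filter (fun j => blk κ j = j)).card ≤ blk κ n + 1 ∧
    K * ((Finset.range (n + 1)).filter (fun j => blk κ j = j)).card ≤ K * (s0 + 1) + blk κ n := by
  induction n with
  | zero =>
    have : ((Finset.range (0 + 1)).filter (fun j => blk κ j = j)).card ≤ 1 := by
      refine (Finset.card_filter_le _ _).trans (by simp)
    constructor
    · omega
    · nlinarith
  | succ n ih =>
    rw [Finset.range_add_one (n := n + 1), Finset.filter_insert]
    have h := blk_bounds κ hκ n
    rcases blk_cases κ hκ n with ⟨h3, h4⟩ | ⟨h3, h4⟩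
    · rw [if_neg (by omega), h4]; exact ih
    · rw [if_pos h4, Finset.card_insert_of_notMem (by simp), h4]
      have := hκ (blk κ n)
      refine ⟨by omega, ?_⟩
      by_cases hs : s0 ≤ blk κ n
      · have := hK _ hs
        rw [mul_add]; omega
      · have h5 : ((Finset.range (n + 1)).filter (fun j => blk κ j = j)).card + 1 ≤ s0 + 1 := by omega
        have := Nat.mul_le_mul_left K h5
        omega

lemma two_log_le (ε : ℝ) (hε : 0 < ε) (D : ℝ) :
    ∀ᶠ l : ℕ in atTop, D + 2 * Real.logb 2 ((l : ℝ) + 2) ≤ ε * l := by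
  have h := (Real.isLittleO_log_id_atTop).def (c := ε / 16) (by positivity)
  have ht : Tendsto (fun l : ℕ => (l : ℝ) + 2) atTop atTop :=
    tendsto_atTop_add_const_right _ _ tendsto_natCast_atTop_atTop
  filter_upwards [ht.eventually h, eventually_ge_atTop 2,
    tendsto_natCast_atTop_atTop.eventually_ge_atTop (2 * D / ε)] with l h1 h2 h3
  simp only [id, Real.norm_eq_abs] at h1
  have hl : (2 : ℝ) ≤ l := by exact_mod_cast h2
  have h4 := (le_abs_self _).trans h1
  rw [abs_of_pos (by linarith)] at h4
  rw [div_le_iff₀ hε] at h3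
  have h5 : Real.logb 2 ((l : ℝ) + 2) ≤ 2 * Real.log ((l : ℝ) + 2) := by
    unfold Real.logb
    rw [div_le_iff₀ (Real.log_pos (by norm_num))]
    have := Real.log_two_gt_d9
    have h6 : 0 ≤ Real.log ((l : ℝ) + 2) := Real.log_nonneg (by linarith)
    nlinarith
  nlinarith

lemma seqs (α β : ℝ) (hβ0 : 0 < β) (hβα : β ≤ α) (hα1 : α < 1)
    (φ : ℝ → ℝ) (hφpos : ∀ t : ℝ, 2 ≤ t → 0 < φ t)
    (hφmono : ∀ s t : ℝ, 2 ≤ s → s ≤ t → φ s ≤ φ t)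
    (hφtop : Tendsto φ atTop atTop) :
    ∃ (a b : ℕ → ℕ) (C : ℝ), 0 < C ∧ a 0 = 0 ∧ b 0 = 0 ∧
      (∀ n, a (n + 1) = a n ∨ a (n + 1) = a n + 1) ∧
      (∀ n, b (n + 1) = b n ∨ b (n + 1) = b n + 1) ∧
      (∀ n, b (n + 1) ≠ b n → a (n + 1) = a n + 1) ∧
      (∀ n : ℕ, ((n : ℝ) + 1) * (2 : ℝ) ^ (α * n) ≤ C * 2 ^ (a n)) ∧
      (∀ n : ℕ, 3 ≤ n → (2 : ℝ) ^ (a n) ≤ C * (φ (2 ^ (n - 2)) * ((n : ℝ) + 1) * (2 : ℝ) ^ (α * n))) ∧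
      (∀ n : ℕ, (2 : ℝ) ^ (b n) * (2 : ℝ) ^ (β / 2 * n) ≤ C * 2 ^ (a n)) ∧
      (∀ ε : ℝ, 0 < ε → ∀ᶠ l : ℕ in atTop, (a l : ℝ) ≤ (α + ε) * l ∧ (α - β / 2 - ε) * l ≤ b l ∧
        (((Finset.range l).filter
          (fun j => b (j + 1) = b j ∧ b (j + 1 + 1) ≠ b (j + 1))).card : ℝ) ≤ ε * l) := by
  set γ : ℝ := α - β / 2 with hγ
  have hγ0 : 0 < γ := by rw [hγ]; linarith
  have hγ1 : γ < 1 := by rw [hγ]; linarith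
  have hα0 : 0 < α := by linarith
  obtain ⟨n0, hn0⟩ := exists_nat_ge (2 / (1 - α))
  have h1α : 0 < 1 - α := by linarith
  have hn0pos : (0 : ℝ) < n0 := lt_of_lt_of_le (by positivity) hn0
  have hn0one : (1 : ℝ) ≤ n0 := by
    have : 0 < n0 := by exact_mod_cast hn0pos
    exact_mod_cast this
  have hn0' : 2 / (n0 : ℝ) ≤ 1 - α := by
    rw [div_le_iff₀ h1α] at hn0
    rw [div_le_iff₀ hn0pos]; linarith
  set Lg : ℕ → ℝ := fun n => Real.logb 2 (1 + n / n0) with hLg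
  have hone : ∀ n : ℕ, (1 : ℝ) ≤ 1 + n / n0 := fun n => by
    have : (0 : ℝ) ≤ n / n0 := by positivity
    linarith
  have hLg0 : ∀ n, 0 ≤ Lg n := fun n => Real.logb_nonneg (by norm_num) (hone n)
  have hLgm : ∀ m n : ℕ, m ≤ n → Lg m ≤ Lg n := fun m n h => by
    refine Real.logb_le_logb_of_le (by norm_num) (by linarith [hone m]) ?_
    have : (m : ℝ) ≤ n := by exact_mod_cast h
    gcongr
  have hLgs : ∀ n, Lg (n + 1) ≤ Lg n + (1 - α) := fun n => by
    refine le_trans ?_ (add_le_add_right hn0' (Lg n))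
    simp only [hLg]
    rw [← sub_le_iff_le_add', ← Real.logb_div (by linarith [hone (n + 1)]) (by linarith [hone n])]
    unfold Real.logb
    rw [div_le_iff₀ (Real.log_pos (by norm_num))]
    have h2 := Real.log_two_gt_d9
    have h3 : Real.log ((1 + ((n + 1 : ℕ) : ℝ) / n0) / (1 + (n : ℝ) / n0)) ≤ 1 / n0 := by
      refine (Real.log_le_sub_one_of_pos (by
        have := hone n; have := hone (n + 1); positivity)).trans ?_
      rw [sub_le_iff_le_add, div_le_iff₀ (by linarith [hone n])]
      push_cast
      have e1 : (0 : ℝ) ≤ n / n0 := by positivity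
      have e2 : (0 : ℝ) ≤ 1 / n0 := by positivity
      rw [add_div]
      nlinarith [mul_nonneg e1 e2]
    have e2 : (0 : ℝ) < 1 / n0 := by positivity
    rw [show (2 : ℝ) / n0 = 2 * (1 / n0) by ring]
    nlinarith
  set K0 : ℕ := ⌈4 / β⌉₊ + 1 with hK0
  have hK0β : 2 ≤ β / 2 * (K0 : ℝ) := by
    have : 4 / β ≤ (K0 : ℝ) := by
      rw [hK0]; push_cast; linarith [Nat.le_ceil (4 / β)]
    rw [div_le_iff₀ hβ0] at this
    linarith
  set κ : ℕ → ℕ := fun s => K0 + min (Nat.log 2 (s + 2))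
    (Nat.log 2 ⌊φ (2 ^ (max (s - 2) 1)) / φ 2⌋₊) with hκdef
  have hκ1 : ∀ s, 1 ≤ κ s := fun s => by simp only [hκdef, hK0]; omega
  have hκle : ∀ s, κ s ≤ K0 + Nat.log 2 (s + 2) := fun s => by simp only [hκdef]; omega
  have hφ2 : 0 < φ 2 := hφpos 2 le_rfl
  have hκlog : ∀ s, (2 : ℝ) ^ (κ s) ≤ 2 ^ K0 * (s + 2) := by
    intro s
    simp only [hκdef]
    rw [pow_add]
    gcongr
    calc (2 : ℝ) ^ (min (Nat.log 2 (s + 2)) (Nat.log 2 ⌊φ (2 ^ (max (s - 2) 1)) / φ 2⌋₊))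
        ≤ 2 ^ (Nat.log 2 (s + 2)) := pow_le_pow_right₀ (by norm_num) (min_le_left _ _)
      _ ≤ _ := by exact_mod_cast Nat.pow_log_le_self 2 (by omega)
  have hpow2 : ∀ s : ℕ, (2 : ℝ) ≤ 2 ^ (max (s - 2) 1) := fun s => by
    calc (2 : ℝ) = 2 ^ 1 := by norm_num
      _ ≤ _ := pow_le_pow_right₀ (by norm_num) (le_max_right _ _)
  have hκφ : ∀ s, (2 : ℝ) ^ (κ s) ≤ 2 ^ K0 * (φ (2 ^ (max (s - 2) 1)) / φ 2) := by
    intro s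
    simp only [hκdef]
    rw [pow_add]
    have hge : 1 ≤ φ (2 ^ (max (s - 2) 1)) / φ 2 := by
      rw [one_le_div hφ2]; exact hφmono _ _ le_rfl (hpow2 s)
    gcongr
    calc (2 : ℝ) ^ (min (Nat.log 2 (s + 2)) (Nat.log 2 ⌊φ (2 ^ (max (s - 2) 1)) / φ 2⌋₊))
        ≤ 2 ^ (Nat.log 2 ⌊φ (2 ^ (max (s - 2) 1)) / φ 2⌋₊) :=
          pow_le_pow_right₀ (by norm_num) (min_le_right _ _)
      _ ≤ (⌊φ (2 ^ (max (s - 2) 1)) / φ 2⌋₊ : ℝ) := by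
          exact_mod_cast Nat.pow_log_le_self 2 (Nat.floor_pos.2 hge).ne'
      _ ≤ _ := Nat.floor_le (by linarith)
  have hκtop : ∀ K : ℕ, ∃ s0, ∀ s, s0 ≤ s → K ≤ κ s := by
    intro K
    have h2 : Tendsto (fun m : ℕ => φ ((2 : ℝ) ^ m)) atTop atTop :=
      hφtop.comp (tendsto_pow_atTop_atTop_of_one_lt (by norm_num))
    obtain ⟨m0, hm0⟩ := (h2.eventually_ge_atTop (2 ^ K * φ 2)).exists_forall_of_atTop
    refine ⟨2 ^ K + m0 + 2, fun s hs => ?_⟩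
    have hpos2 : 0 < 2 ^ K := by positivity
    have e1 : K ≤ Nat.log 2 (s + 2) := Nat.le_log_of_pow_le (by norm_num) (by omega)
    have e2 : K ≤ Nat.log 2 ⌊φ (2 ^ (max (s - 2) 1)) / φ 2⌋₊ := by
      refine Nat.le_log_of_pow_le (by norm_num) (Nat.le_floor ?_)
      push_cast
      rw [le_div_iff₀ hφ2]
      exact hm0 _ (by omega)
    simp only [hκdef]
    have := le_min e1 e2
    omega
  set τa : ℕ → ℕ := fun n => ⌈α * n + Lg n⌉₊ with hτa
  set τb : ℕ → ℕ := fun n => ⌊γ * n⌋₊ with hτb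
  have hA : ∀ n, τa n ≤ τa (n + 1) ∧ τa (n + 1) ≤ τa n + 1 := by
    intro n
    simp only [hτa]
    constructor
    · apply Nat.ceil_mono
      have := hLgm n (n + 1) (by omega)
      push_cast; nlinarith
    · rw [Nat.ceil_le]
      have := hLgs n
      have := Nat.le_ceil (α * n + Lg n)
      push_cast; linarith
  have hB : ∀ n, τb n ≤ τb (n + 1) ∧ τb (n + 1) ≤ τb n + 1 := by
    intro n
    simp only [hτb]
    constructor
    · apply Nat.floor_mono
      push_cast; nlinarith
    · refine Nat.le_of_lt_succ ?_
      rw [Nat.floor_lt (by positivity)]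
      have := Nat.lt_floor_add_one (γ * n)
      push_cast; linarith
  have haU : ∀ n : ℕ, (τa n : ℝ) < α * n + Lg n + 1 := fun n =>
    Nat.ceil_lt_add_one (by have := hLg0 n; positivity)
  have haL : ∀ n : ℕ, α * n + Lg n ≤ τa n := fun n => Nat.le_ceil _
  have hbU : ∀ n : ℕ, (τb n : ℝ) ≤ γ * n := fun n => Nat.floor_le (by positivity)
  have hbL : ∀ n : ℕ, γ * n < τb n + 1 := fun n => Nat.lt_floor_add_one _
  have hAB : ∀ s, τb (s + κ s) + τa s ≤ τa (s + κ s) + τb s := by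
    intro s
    have e1 := haU s
    have e2 := haL (s + κ s)
    have e3 := hbU (s + κ s)
    have e4 := hbL s
    have e5 := hLgm s (s + κ s) (by omega)
    have e6 : (K0 : ℝ) ≤ κ s := by exact_mod_cast (show K0 ≤ κ s by simp only [hκdef]; omega)
    have e7 : 2 ≤ β / 2 * (κ s : ℝ) := hK0β.trans (by gcongr)
    have : ((τb (s + κ s) + τa s : ℕ) : ℝ) ≤ ((τa (s + κ s) + τb s : ℕ) : ℝ) := by
      push_cast at *
      rw [hγ] at e3 e4
      linarith
    exact_mod_cast this
  have hta := til_bounds κ τa hκ1 hA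
  have htb := til_bounds κ τb hκ1 hB
  have hrp : ∀ m : ℕ, (2 : ℝ) ^ m = (2 : ℝ) ^ (m : ℝ) := fun m => (Real.rpow_natCast 2 m).symm
  have hLpow : ∀ n : ℕ, (2 : ℝ) ^ (α * n + Lg n) = (2 : ℝ) ^ (α * n) * (1 + n / n0) := by
    intro n
    rw [Real.rpow_add (by norm_num), Real.rpow_logb (by norm_num) (by norm_num)]
    linarith [hone n]
  have hn0n : ∀ n : ℕ, (n : ℝ) + 1 ≤ n0 * (1 + n / n0) := by
    intro n
    rw [mul_add, mul_one, mul_div_cancel₀ _ hn0pos.ne']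
    linarith
  have hn0u : ∀ n : ℕ, (1 : ℝ) + n / n0 ≤ n + 1 := by
    intro n
    have : (n : ℝ) / n0 ≤ n := div_le_self (by positivity) hn0one
    linarith
  have hlow : ∀ n : ℕ, ((n : ℝ) + 1) * (2 : ℝ) ^ (α * n) ≤ n0 * 2 ^ (til κ τa n) := by
    intro n
    have h1 : (2 : ℝ) ^ (α * n + Lg n) ≤ 2 ^ (til κ τa n) := by
      rw [hrp]
      refine Real.rpow_le_rpow_of_exponent_le (by norm_num) ((haL n).trans ?_)
      exact_mod_cast (hta n).1
    rw [hLpow] at h1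
    calc ((n : ℝ) + 1) * (2 : ℝ) ^ (α * n) ≤ (n0 * (1 + n / n0)) * (2 : ℝ) ^ (α * n) := by
          gcongr; exact hn0n n
      _ = n0 * ((2 : ℝ) ^ (α * n) * (1 + n / n0)) := by ring
      _ ≤ _ := by gcongr
  have hblk := blk_bounds κ hκ1
  have hup : ∀ n : ℕ, (2 : ℝ) ^ (til κ τa n) ≤
      2 * (((n : ℝ) + 1) * (2 : ℝ) ^ (α * n)) * 2 ^ (κ (blk κ n)) := by
    intro n
    calc (2 : ℝ) ^ (til κ τa n) ≤ 2 ^ (τa n + κ (blk κ n)) :=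
          pow_le_pow_right₀ (by norm_num) (hta n).2
      _ = 2 ^ (τa n) * 2 ^ (κ (blk κ n)) := pow_add _ _ _
      _ ≤ _ := by
          gcongr
          rw [hrp]
          calc (2 : ℝ) ^ ((τa n : ℝ)) ≤ (2 : ℝ) ^ (α * n + Lg n + 1) :=
                Real.rpow_le_rpow_of_exponent_le (by norm_num) (haU n).le
            _ = 2 * ((1 + n / n0) * (2 : ℝ) ^ (α * n)) := by
                rw [Real.rpow_add (by norm_num), hLpow, Real.rpow_one]; ring
            _ ≤ _ := by gcongr 2 * (?_ * _); exact hn0u n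
  set C : ℝ := n0 + 2 * 2 ^ K0 / φ 2 + 2 * 2 ^ K0 * n0 with hC
  have hC1 : (n0 : ℝ) ≤ C := by
    have : 0 ≤ 2 * 2 ^ K0 / φ 2 := by positivity
    have : (0 : ℝ) ≤ 2 * 2 ^ K0 * n0 := by positivity
    linarith
  have hC2 : 2 * 2 ^ K0 / φ 2 ≤ C := by
    have : (0 : ℝ) ≤ 2 * 2 ^ K0 * n0 := by positivity
    linarith
  have hC3 : 2 * 2 ^ K0 * (n0 : ℝ) ≤ C := by
    have : 0 ≤ 2 * 2 ^ K0 / φ 2 := by positivity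
    linarith
  refine ⟨til κ τa, til κ τb, C, by linarith, ?_, ?_, ?_, ?_, til_sub κ τa τb hκ1 hA hB hAB,
    ?_, ?_, ?_, ?_⟩
  · simp [til, blk, hτa, hLg]
  · simp [til, blk, hτb]
  · intro n; rw [til_step κ τa hκ1 hA]; split_ifs <;> simp
  · intro n; rw [til_step κ τb hκ1 hB]; split_ifs <;> simp
  · intro n
    exact (hlow n).trans (by gcongr)
  · intro n hn
    refine (hup n).trans ?_
    have h1 : φ (2 ^ (max (blk κ n - 2) 1)) ≤ φ (2 ^ (n - 2)) := by
      refine hφmono _ _ (hpow2 _) (pow_le_pow_right₀ (by norm_num) ?_)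
      have := (hblk n).1
      omega
    have h2 : 0 < φ (2 ^ (max (blk κ n - 2) 1)) := hφpos _ (hpow2 _)
    calc 2 * (((n : ℝ) + 1) * (2 : ℝ) ^ (α * n)) * 2 ^ (κ (blk κ n))
        ≤ 2 * (((n : ℝ) + 1) * (2 : ℝ) ^ (α * n)) * (2 ^ K0 * (φ (2 ^ (n - 2)) / φ 2)) := by
          gcongr
          exact (hκφ _).trans (by gcongr)
      _ = (2 * 2 ^ K0 / φ 2) * (φ (2 ^ (n - 2)) * ((n : ℝ) + 1) * (2 : ℝ) ^ (α * n)) := by ring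
      _ ≤ _ := by
          have : 0 < φ (2 ^ (n - 2)) := lt_of_lt_of_le h2 h1
          gcongr
  · intro n
    calc (2 : ℝ) ^ (til κ τb n) * (2 : ℝ) ^ (β / 2 * n)
        ≤ (2 : ℝ) ^ (τb n + κ (blk κ n)) * (2 : ℝ) ^ (β / 2 * n) := by
          gcongr
          · norm_num
          · exact (htb n).2
      _ = (2 : ℝ) ^ ((τb n : ℝ)) * 2 ^ (κ (blk κ n)) * (2 : ℝ) ^ (β / 2 * n) := by
          rw [pow_add, hrp (τb n)]
      _ ≤ (2 : ℝ) ^ (γ * n) * (2 ^ K0 * (2 * (n + 1))) * (2 : ℝ) ^ (β / 2 * n) := by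
          gcongr
          · norm_num
          · exact hbU n
          · refine (hκlog _).trans ?_
            have : (blk κ n : ℝ) ≤ n := by exact_mod_cast (hblk n).1
            gcongr; linarith [(Nat.cast_nonneg n : (0 : ℝ) ≤ n)]
      _ = 2 * 2 ^ K0 * (((n : ℝ) + 1) * ((2 : ℝ) ^ (γ * n) * (2 : ℝ) ^ (β / 2 * n))) := by ring
      _ = 2 * 2 ^ K0 * (((n : ℝ) + 1) * (2 : ℝ) ^ (α * n)) := by
          rw [← Real.rpow_add (by norm_num), ← add_mul, hγ]; simp
      _ ≤ 2 * 2 ^ K0 * (n0 * 2 ^ (til κ τa n)) :=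
          mul_le_mul_of_nonneg_left (hlow n) (by positivity)
      _ = 2 * 2 ^ K0 * n0 * 2 ^ (til κ τa n) := by ring
      _ ≤ _ := by gcongr
  · intro ε hε
    obtain ⟨K, hK⟩ := exists_nat_gt (4 / ε)
    obtain ⟨s0, hs0⟩ := hκtop K
    have hKpos : (0 : ℝ) < K := lt_of_le_of_lt (by positivity) hK
    filter_upwards [two_log_le ε hε (1 + K0),
      tendsto_natCast_atTop_atTop.eventually_ge_atTop (1 / ε),
      tendsto_natCast_atTop_atTop.eventually_ge_atTop (2 * ((s0 : ℝ) + 1) / ε),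
      eventually_ge_atTop 1] with l h1 h2 h3 h4
    have hl1 : (1 : ℝ) ≤ l := by exact_mod_cast h4
    refine ⟨?_, ?_, ?_⟩
    · have e1 : (til κ τa l : ℝ) ≤ τa l + κ (blk κ l) := by exact_mod_cast (hta l).2
      have e2 := haU l
      have e3 : Lg l ≤ Real.logb 2 ((l : ℝ) + 2) :=
        Real.logb_le_logb_of_le (by norm_num) (by linarith [hone l]) (by linarith [hn0u l])
      have e4 : (κ (blk κ l) : ℝ) ≤ K0 + Real.logb 2 ((l : ℝ) + 2) := by
        have e5 : (κ (blk κ l) : ℝ) ≤ K0 + Nat.log 2 (l + 2) := by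
          have : κ (blk κ l) ≤ K0 + Nat.log 2 (l + 2) := by
            have e6 : κ (blk κ l) ≤ K0 + Nat.log 2 (blk κ l + 2) := hκle _
            have : Nat.log 2 (blk κ l + 2) ≤ Nat.log 2 (l + 2) :=
              Nat.log_mono_right (by have := (hblk l).1; omega)
            omega
          exact_mod_cast this
        refine e5.trans (add_le_add_right ?_ _)
        rw [Real.le_logb_iff_rpow_le (by norm_num) (by positivity), Real.rpow_natCast]
        exact_mod_cast Nat.pow_log_le_self 2 (by omega)
      linarith
    · have e1 : (τb l : ℝ) ≤ til κ τb l := by exact_mod_cast (htb l).1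
      have e2 := hbL l
      rw [div_le_iff₀ hε] at h2
      linarith
    · have hc := (blk_count κ hκ1 K s0 hs0 l).2
      have hle : ((Finset.range l).filter (fun j => til κ τb (j + 1) = til κ τb j ∧
          til κ τb (j + 1 + 1) ≠ til κ τb (j + 1))).card ≤
          ((Finset.range (l + 1)).filter (fun j => blk κ j = j)).card := by
        refine Finset.card_le_card_of_injOn (fun j => j + 1) ?_ (fun x _ y _ h => by simpa using h)
        intro j hj
        simp only [Finset.coe_filter, Finset.mem_range, Set.mem_ofPred_eq] at hj ⊢
        exact ⟨by omega, til_run κ τb hκ1 hB j hj.2.1 hj.2.2⟩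
      set R := ((Finset.range l).filter (fun j => til κ τb (j + 1) = til κ τb j ∧
          til κ τb (j + 1 + 1) ≠ til κ τb (j + 1))).card with hR
      have h5 : K * R ≤ K * (s0 + 1) + l := by
        have := Nat.mul_le_mul_left K hle
        have := (hblk l).1
        omega
      have h6 : (K : ℝ) * R ≤ K * (s0 + 1) + l := by exact_mod_cast h5
      rw [div_le_iff₀ hε] at h3
      rw [div_lt_iff₀ hε] at hK
      have h7 : (K : ℝ) * R ≤ K * (ε * l) := by nlinarith
      exact le_of_mul_le_mul_left h7 hKpos

open Classical in
/-- integers with binary digits prescribed to vanish off `D` -/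
noncomputable def gap (D : ℕ → Prop) (S0 : Finset ℕ) : ℕ → Finset ℕ
  | 0 => S0
  | n + 1 => (gap D S0 n).image (fun x => 2 * x) ∪
      (if D n then (gap D S0 n).image (fun x => 2 * x + 1) else ∅)

lemma mem_gap_succ (D : ℕ → Prop) (S0 : Finset ℕ) (n x : ℕ) :
    x ∈ gap D S0 (n + 1) ↔ (∃ y ∈ gap D S0 n, x = 2 * y) ∨ (D n ∧ ∃ y ∈ gap D S0 n, x = 2 * y + 1) := by
  classical
  by_cases h : D n <;> simp [gap, h, eq_comm]

lemma card_gap (D : ℕ → Prop) [DecidablePred D] (S0 : Finset ℕ) (n : ℕ) :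
    (gap D S0 n).card = S0.card * 2 ^ ((Finset.range n).filter D).card := by
  induction n with
  | zero => simp [gap]
  | succ n ih =>
    have h1 : ((gap D S0 n).image (fun x => 2 * x)).card = (gap D S0 n).card :=
      Finset.card_image_of_injective _ fun x y h => by simpa using h
    have h2 : ((gap D S0 n).image (fun x => 2 * x + 1)).card = (gap D S0 n).card :=
      Finset.card_image_of_injective _ fun x y h => by simpa using h
    rw [Finset.range_add_one, Finset.filter_insert]
    by_cases h : D n
    · rw [if_pos h, Finset.card_insert_of_notMem (by simp), pow_succ]
      simp only [gap, if_pos h]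
      rw [Finset.card_union_of_disjoint, h1, h2, ih]
      · ring
      · rw [Finset.disjoint_left]
        intro x hx hy
        simp only [Finset.mem_image] at hx hy
        obtain ⟨y, _, rfl⟩ := hx
        obtain ⟨z, _, hz⟩ := hy
        omega
    · rw [if_neg h]
      simp only [gap, if_neg h, Finset.union_empty]
      rw [h1, ih]

lemma gap_add (D' D : ℕ → Prop) (hD : ∀ j, D j ↔ (D' j ∨ D' (j + 1))) (l : ℕ) :
    ∀ p ∈ gap D' {0} l, ∀ p' ∈ gap D' {0} l, p + p' ∈ gap D {0, 1} l ∧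
      (D' l → p + p' + 1 ∈ gap D {0, 1} l) := by
  induction l with
  | zero => intro p hp p' hp'; simp [gap] at *; subst hp; subst hp'; simp
  | succ l ih =>
    intro p hp p' hp'
    rw [mem_gap_succ] at hp hp'
    simp only [mem_gap_succ]
    rcases hp with ⟨x, hx, rfl⟩ | ⟨hl, x, hx, rfl⟩ <;>
    rcases hp' with ⟨y, hy, rfl⟩ | ⟨hl', y, hy, rfl⟩ <;>
    have h1 := ih x hx y hy
    · refine ⟨Or.inl ⟨_, h1.1, by ring⟩, fun h => Or.inr ⟨(hD l).2 (Or.inr h), _, h1.1, by ring⟩⟩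
    · refine ⟨Or.inr ⟨(hD l).2 (Or.inl hl'), _, h1.1, by ring⟩,
        fun h => Or.inl ⟨_, h1.2 hl', by ring⟩⟩
    · refine ⟨Or.inr ⟨(hD l).2 (Or.inl hl), _, h1.1, by ring⟩,
        fun h => Or.inl ⟨_, h1.2 hl, by ring⟩⟩
    · refine ⟨Or.inl ⟨_, h1.2 hl, by ring⟩,
        fun h => Or.inr ⟨(hD l).2 (Or.inl hl), _, h1.2 hl, by ring⟩⟩

/-- the structured cells -/
noncomputable def Pst (b : ℕ → ℕ) (n : ℕ) : Finset ℕ := gap (fun j => b (j + 1) ≠ b j) {0} n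

/-- the auxiliary enlarged structured cells -/
noncomputable def Qst (b : ℕ → ℕ) (n : ℕ) : Finset ℕ :=
  gap (fun j => b (j + 1) ≠ b j ∨ b (j + 1 + 1) ≠ b (j + 1)) {0, 1} n

lemma Pst_add (b : ℕ → ℕ) (l p p' : ℕ) (hp : p ∈ Pst b l) (hp' : p' ∈ Pst b l) :
    p + p' ∈ Qst b l :=
  (gap_add (fun j => b (j + 1) ≠ b j) _ (fun _ => Iff.rfl) l p hp p' hp').1

lemma card_filter_b (b : ℕ → ℕ) (hb0 : b 0 = 0) (hb : ∀ n, b (n + 1) = b n ∨ b (n + 1) = b n + 1)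
    (n : ℕ) : ((Finset.range n).filter (fun j => b (j + 1) ≠ b j)).card = b n := by
  induction n with
  | zero => simp [hb0]
  | succ n ih =>
    rw [Finset.range_add_one, Finset.filter_insert]
    rcases hb n with h | h
    · rw [if_neg (by simp [h]), ih, h]
    · rw [if_pos (by omega), Finset.card_insert_of_notMem (by simp), ih, h]

lemma card_Pst (b : ℕ → ℕ) (hb0 : b 0 = 0) (hb : ∀ n, b (n + 1) = b n ∨ b (n + 1) = b n + 1)
    (n : ℕ) : (Pst b n).card = 2 ^ b n := by
  unfold Pst
  rw [card_gap, card_filter_b b hb0 hb]; simp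

lemma card_Qst (b : ℕ → ℕ) (hb0 : b 0 = 0) (hb : ∀ n, b (n + 1) = b n ∨ b (n + 1) = b n + 1)
    (n : ℕ) : 2 ^ b n ≤ (Qst b n).card ∧ (Qst b n).card ≤ 2 * 2 ^ (b n + ((Finset.range n).filter
      (fun j => b (j + 1) = b j ∧ b (j + 1 + 1) ≠ b (j + 1))).card) := by
  unfold Qst
  rw [card_gap]
  have h0 : ({0, 1} : Finset ℕ).card = 2 := rfl
  rw [h0]
  have h1 : ((Finset.range n).filter (fun j => b (j + 1) ≠ b j)).card ≤
    ((Finset.range n).filter (fun j => b (j + 1) ≠ b j ∨ b (j + 1 + 1) ≠ b (j + 1))).card :=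
    Finset.card_le_card (Finset.monotone_filter_right _ fun j _ h => Or.inl h)
  have h2 : ((Finset.range n).filter (fun j => b (j + 1) ≠ b j ∨ b (j + 1 + 1) ≠ b (j + 1))).card ≤
      ((Finset.range n).filter (fun j => b (j + 1) ≠ b j)).card + ((Finset.range n).filter
      (fun j => b (j + 1) = b j ∧ b (j + 1 + 1) ≠ b (j + 1))).card := by
    refine le_trans (Finset.card_le_card ?_) (Finset.card_union_le _ _)
    intro j
    simp only [Finset.mem_union, Finset.mem_filter]
    tauto
  rw [card_filter_b b hb0 hb] at h1 h2
  constructor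
  · have := Nat.pow_le_pow_right (show 0 < 2 by norm_num) h1
    omega
  · have := Nat.pow_le_pow_right (show 0 < 2 by norm_num) h2
    omega

/-- sign choice for a set of cells -/
noncomputable def sgn (n : ℕ) (S : Finset ℕ) : ℕ → ℝ :=
  Classical.choose (signs n (S.filter (fun m => m < 2 ^ n))
    (fun _ hm => (Finset.mem_filter.1 hm).2))

lemma sgn_spec (n : ℕ) (S : Finset ℕ) (hS : ∀ m ∈ S, m < 2 ^ n) :
    (∀ m, sgn n S m = 1 ∨ sgn n S m = -1) ∧ ∀ θ : ℝ,
      ‖∑ m ∈ S, (sgn n S m : ℂ) * ech (θ * m)‖ ≤ 20 * Real.sqrt (S.card * (n + 1)) := by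
  have h := Classical.choose_spec (signs n (S.filter (fun m => m < 2 ^ n))
    (fun _ hm => (Finset.mem_filter.1 hm).2))
  have h2 : S.filter (fun m => m < 2 ^ n) = S := Finset.filter_true_of_mem hS
  change (∀ m, sgn n S m = 1 ∨ sgn n S m = -1) ∧ ∀ θ : ℝ,
      ‖∑ m ∈ S.filter (fun m => m < 2 ^ n), (sgn n S m : ℂ) * ech (θ * m)‖ ≤
        20 * Real.sqrt ((S.filter (fun m => m < 2 ^ n)).card * (n + 1)) at h
  rw [h2] at h
  exact h

open Classical in
noncomputable def edig (b : ℕ → ℕ) (n : ℕ) (S : Finset ℕ) (j : ℕ) : ℕ :=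
  if j ∈ Pst b n then 0 else if sgn n (S \ Pst b n) j = 1 then 0 else 1

open Classical in
noncomputable def tree (a b : ℕ → ℕ) : ℕ → (ℕ → ℕ)
  | 0 => fun _ => 0
  | n + 1 => if a (n + 1) = a n then
      fun k => 2 * tree a b n k +
        edig b n ((Finset.range (2 ^ a n)).image (tree a b n)) (tree a b n k)
    else fun k => 2 * tree a b n (k / 2) + k % 2

lemma edig_le (b : ℕ → ℕ) (n : ℕ) (S : Finset ℕ) (j : ℕ) : edig b n S j ≤ 1 := by
  unfold edig; split_ifs <;> simp

lemma tree_lt (a b : ℕ → ℕ) (n k : ℕ) : tree a b n k < 2 ^ n := by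
  induction n generalizing k with
  | zero => simp [tree]
  | succ n ih =>
    by_cases h : a (n + 1) = a n
    · simp only [tree, if_pos h]
      have h1 := ih k
      have h2 := edig_le b n ((Finset.range (2 ^ a n)).image (tree a b n)) (tree a b n k)
      rw [pow_succ]
      convert (show 2 * tree a b n k +
        edig b n ((Finset.range (2 ^ a n)).image (tree a b n)) (tree a b n k) < 2 ^ n * 2 by omega)
    · simp only [tree, if_neg h]
      have h1 := ih (k / 2)
      rw [pow_succ]; omega

lemma tree_exists (a b : ℕ → ℕ) (ha0 : a 0 = 0) (hb0 : b 0 = 0)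
    (ha : ∀ n, a (n + 1) = a n ∨ a (n + 1) = a n + 1)
    (hb : ∀ n, b (n + 1) = b n ∨ b (n + 1) = b n + 1)
    (hba : ∀ n, b (n + 1) ≠ b n → a (n + 1) = a n + 1) :
    ∃ (s e : ℕ → ℕ → ℕ), (∀ k, s 0 k = 0) ∧
      (∀ n, a (n + 1) ≠ a n → ∀ k, s (n + 1) k = 2 * s n (k / 2) + k % 2) ∧
      (∀ n, a (n + 1) = a n → ∀ k, s (n + 1) k = 2 * s n k + e n k) ∧
      (∀ n k, e n k ≤ 1) ∧
      (∀ n, Set.InjOn (s n) (Finset.range (2 ^ a n))) ∧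
      (∀ n, ∀ p ∈ Pst b n, ∃ k < 2 ^ a n, s n k = p) ∧
      (∀ (n : ℕ) (θ : ℝ), ‖∑ k ∈ Finset.range (2 ^ a n),
        ((1 - 2 * (e n k : ℝ) : ℝ) : ℂ) * ech (θ * s n k)‖ ≤
          20 * Real.sqrt (2 ^ a n * (n + 1)) + 2 ^ b n) := by
  classical
  set I : ℕ → Finset ℕ := fun n => (Finset.range (2 ^ a n)).image (tree a b n) with hI
  have hs1 : ∀ n, a (n + 1) ≠ a n → ∀ k, tree a b (n + 1) k = 2 * tree a b n (k / 2) + k % 2 := by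
    intro n hn k; simp only [tree, if_neg hn]
  have hs2 : ∀ n, a (n + 1) = a n → ∀ k,
      tree a b (n + 1) k = 2 * tree a b n k + edig b n (I n) (tree a b n k) := by
    intro n hn k; simp only [tree, if_pos hn, hI]
  have hinj : ∀ n, Set.InjOn (tree a b n) (Finset.range (2 ^ a n)) := by
    intro n
    induction n with
    | zero => intro x hx y hy _; simp [ha0] at hx hy; omega
    | succ n ih =>
      intro x hx y hy hxy
      simp only [Finset.coe_range, Set.mem_Iio] at hx hy ih
      by_cases h : a (n + 1) = a n
      · rw [hs2 n h, hs2 n h] at hxy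
        have h1 := edig_le b n (I n) (tree a b n x)
        have h2 := edig_le b n (I n) (tree a b n y)
        rw [h] at hx hy
        exact ih hx hy (by omega)
      · rw [hs1 n h, hs1 n h] at hxy
        have h3 := (ha n).resolve_left h
        rw [h3, pow_succ] at hx hy
        have h4 : x / 2 = y / 2 := by
          refine ih ?_ ?_ (by omega)
          · simp only [Set.mem_Iio]; omega
          · simp only [Set.mem_Iio]; omega
        omega
  refine ⟨tree a b, fun n k => edig b n (I n) (tree a b n k), fun k => rfl, hs1, hs2,
    fun n k => edig_le _ _ _ _, hinj, ?_, ?_⟩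
  · intro n
    induction n with
    | zero => intro p hp; simp [Pst, gap] at hp; exact ⟨0, by simp, by simp [tree, hp]⟩
    | succ n ih =>
      intro p hp
      unfold Pst at hp
      rw [mem_gap_succ] at hp
      by_cases h : a (n + 1) = a n
      · rcases hp with ⟨y, hy, rfl⟩ | ⟨hD, _⟩
        · obtain ⟨k, hk, hky⟩ := ih y hy
          refine ⟨k, by rw [h]; exact hk, ?_⟩
          rw [hs2 n h, hky]
          have : edig b n (I n) y = 0 := by
            unfold edig; rw [if_pos]; exact hy
          rw [this]; rfl
        · have := hba n hD; omega
      · have h3 := (ha n).resolve_left h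
        rcases hp with ⟨y, hy, rfl⟩ | ⟨hD, y, hy, rfl⟩
        · obtain ⟨k, hk, hky⟩ := ih y hy
          refine ⟨2 * k, by rw [h3, pow_succ]; omega, ?_⟩
          rw [hs1 n h, show 2 * k / 2 = k by omega, hky]; omega
        · obtain ⟨k, hk, hky⟩ := ih y hy
          refine ⟨2 * k + 1, by rw [h3, pow_succ]; omega, ?_⟩
          rw [hs1 n h, show (2 * k + 1) / 2 = k by omega, hky]; omega
  · intro n θ
    have h1 : ∑ k ∈ Finset.range (2 ^ a n),
        ((1 - 2 * (edig b n (I n) (tree a b n k) : ℝ) : ℝ) : ℂ) * ech (θ * tree a b n k) =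
        ∑ j ∈ I n, ((1 - 2 * (edig b n (I n) j : ℝ) : ℝ) : ℂ) * ech (θ * j) := by
      simp only [hI]
      rw [Finset.sum_image (hinj n)]
    rw [h1, ← Finset.sum_inter_add_sum_sdiff (I n) (Pst b n), add_comm]
    refine (norm_add_le _ _).trans (add_le_add ?_ ?_)
    · have hlt : ∀ m ∈ I n \ Pst b n, m < 2 ^ n := by
        intro m hm
        have := (Finset.mem_sdiff.1 hm).1
        simp only [hI, Finset.mem_image] at this
        obtain ⟨k, _, rfl⟩ := this
        exact tree_lt a b n k
      obtain ⟨hsg, hbd⟩ := sgn_spec n (I n \ Pst b n) hlt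
      have h2 : ∑ j ∈ I n \ Pst b n, ((1 - 2 * (edig b n (I n) j : ℝ) : ℝ) : ℂ) * ech (θ * j) =
          ∑ j ∈ I n \ Pst b n, (sgn n (I n \ Pst b n) j : ℂ) * ech (θ * j) := by
        refine Finset.sum_congr rfl fun j hj => ?_
        congr 2
        have hjP := (Finset.mem_sdiff.1 hj).2
        unfold edig
        rw [if_neg hjP]
        rcases hsg j with h | h
        · simp [h]
        · have : ¬ ((-1 : ℝ) = 1) := by norm_num
          simp [h, this]; norm_num
      rw [h2]
      refine (hbd θ).trans ?_
      have h3 : ((I n \ Pst b n).card : ℝ) ≤ 2 ^ a n := by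
        have : (I n \ Pst b n).card ≤ 2 ^ a n := by
          refine (Finset.card_le_card Finset.sdiff_subset).trans ?_
          simp only [hI]
          refine Finset.card_image_le.trans (by simp)
        exact_mod_cast this
      gcongr
    · calc _ ≤ ∑ j ∈ I n ∩ Pst b n, (1 : ℝ) := by
            refine norm_sum_le_of_le _ fun j hj => ?_
            have hjP := (Finset.mem_inter.1 hj).2
            unfold edig
            rw [if_pos hjP, norm_mul, norm_ech]; simp
        _ = (I n ∩ Pst b n).card := by simp
        _ ≤ 2 ^ b n := by
            have : (I n ∩ Pst b n).card ≤ 2 ^ b n := by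
              rw [← card_Pst b hb0 hb n]
              exact Finset.card_le_card Finset.inter_subset_right
            exact_mod_cast this


lemma map_floor (A : ℕ) : (volume.restrict (Set.Ico (0 : ℝ) 1)).map (fun u : ℝ => ⌊(2 : ℝ) ^ A * u⌋₊) =
    ∑ k ∈ Finset.range (2 ^ A), (ENNReal.ofReal (1 / 2 ^ A)) • Measure.dirac k := by
  have hm : Measurable (fun u : ℝ => ⌊(2 : ℝ) ^ A * u⌋₊) :=
    Nat.measurable_floor.comp (measurable_const.mul measurable_id)
  have hA : (0 : ℝ) < 2 ^ A := by positivity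
  refine Measure.ext_of_singleton fun j => ?_
  rw [Measure.map_apply hm (measurableSet_singleton j),
    Measure.restrict_apply (hm (measurableSet_singleton j))]
  simp only [Measure.coe_finsetSum, Finset.sum_apply, Measure.smul_apply, smul_eq_mul,
    Measure.dirac_apply' _ (measurableSet_singleton j)]
  by_cases hj : j < 2 ^ A
  · have : (fun u : ℝ => ⌊(2 : ℝ) ^ A * u⌋₊) ⁻¹' {j} ∩ Set.Ico (0 : ℝ) 1 =
        Set.Ico ((j : ℝ) / 2 ^ A) ((j + 1 : ℝ) / 2 ^ A) := by
      ext u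
      simp only [Set.mem_inter_iff, Set.mem_preimage, Set.mem_singleton_iff, Set.mem_Ico]
      rw [div_le_iff₀ hA, lt_div_iff₀ hA]
      constructor
      · rintro ⟨h1, h2, h3⟩
        rw [Nat.floor_eq_iff (by positivity)] at h1
        exact ⟨by linarith, by linarith⟩
      · rintro ⟨h1, h2⟩
        have h0 : 0 ≤ u := by
          by_contra h; push Not at h
          have : (0 : ℝ) ≤ j := Nat.cast_nonneg j
          nlinarith
        refine ⟨?_, h0, ?_⟩
        · rw [Nat.floor_eq_iff (by positivity)]
          exact ⟨by linarith, by linarith⟩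
        · have : (j : ℝ) + 1 ≤ 2 ^ A := by exact_mod_cast hj
          by_contra h; push Not at h
          nlinarith
    rw [this, Real.volume_Ico, Finset.sum_eq_single j]
    · rw [show ((j : ℝ) + 1) / 2 ^ A - (j : ℝ) / 2 ^ A = 1 / 2 ^ A by ring,
        Set.indicator_of_mem (by simp)]
      simp only [Pi.one_apply, mul_one]
    · intro b _ hb; simp [hb]
    · intro h; simp at h; omega
  · have : (fun u : ℝ => ⌊(2 : ℝ) ^ A * u⌋₊) ⁻¹' {j} ∩ Set.Ico (0 : ℝ) 1 = ∅ := by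
      ext u
      simp only [Set.mem_inter_iff, Set.mem_preimage, Set.mem_singleton_iff, Set.mem_Ico,
        Set.mem_empty_iff_false, iff_false]
      rintro ⟨h1, h2, h3⟩
      apply hj
      rw [← h1, Nat.floor_lt (by positivity)]
      push_cast
      nlinarith
    rw [this, measure_empty, Finset.sum_eq_zero]
    intro b hb
    have : b ≠ j := by rintro rfl; exact hj (Finset.mem_range.1 hb)
    simp [this]

lemma measure_exists (a : ℕ → ℕ) (s e : ℕ → ℕ → ℕ)
    (ha : ∀ n, a (n + 1) = a n ∨ a (n + 1) = a n + 1)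
    (hs1 : ∀ n, a (n + 1) ≠ a n → ∀ k, s (n + 1) k = 2 * s n (k / 2) + k % 2)
    (hs2 : ∀ n, a (n + 1) = a n → ∀ k, s (n + 1) k = 2 * s n k + e n k)
    (he : ∀ n k, e n k ≤ 1) :
    ∃ (E : Set ℝ) (μ : Measure ℝ), IsCompact E ∧ IsProbabilityMeasure μ ∧ μ E = 1 ∧
      (∀ x ∈ E, ∀ n, ∃ k < 2 ^ a n, x ∈ Set.Icc ((s n k : ℝ) / 2 ^ n) (((s n k : ℝ) + 1) / 2 ^ n)) ∧
      (∀ (n : ℕ) (T : Finset ℕ) (A : Set ℝ), MeasurableSet A → T ⊆ Finset.range (2 ^ a n) →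
        (∀ k ∈ T, Set.Icc ((s n k : ℝ) / 2 ^ n) (((s n k : ℝ) + 1) / 2 ^ n) ⊆ A) →
        (T.card : ℝ) / 2 ^ a n ≤ (μ A).toReal) ∧
      (∀ (n : ℕ) (T : Finset ℕ) (A : Set ℝ), MeasurableSet A →
        (∀ k < 2 ^ a n, (Set.Icc ((s n k : ℝ) / 2 ^ n) (((s n k : ℝ) + 1) / 2 ^ n) ∩ A).Nonempty →
          k ∈ T) → (μ A).toReal ≤ (T.card : ℝ) / 2 ^ a n) ∧
      (∀ ξ : ℝ, Tendsto (fun n => ((1 / 2 ^ a n : ℝ) : ℂ) *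
        ∑ k ∈ Finset.range (2 ^ a n), ech (ξ * ((s n k : ℝ) / 2 ^ n))) atTop
        (nhds (∫ x, ech (ξ * x) ∂μ))) := by
  classical
  set fl : ℕ → ℝ → ℕ := fun n u => ⌊(2 : ℝ) ^ a n * u⌋₊ with hfl
  have hflm : ∀ n, Measurable (fl n) := fun n =>
    Nat.measurable_floor.comp (measurable_const.mul measurable_id)
  set m : ℕ → ℝ → ℕ := fun n u => s n (fl n u) with hm
  have hmm : ∀ n, Measurable (m n) := fun n => (measurable_from_top (f := s n)).comp (hflm n)
  have hmstep : ∀ n u, 2 * m n u ≤ m (n + 1) u ∧ m (n + 1) u ≤ 2 * m n u + 1 := by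
    intro n u
    by_cases h : a (n + 1) = a n
    · simp only [hm, hfl]
      rw [hs2 n h, h]
      have := he n ⌊(2 : ℝ) ^ a n * u⌋₊
      omega
    · have h3 := (ha n).resolve_left h
      have h4 : fl (n + 1) u / 2 = fl n u := by
        simp only [hfl]
        rw [h3, ← Nat.floor_div_ofNat, pow_succ]
        congr 1; ring
      simp only [hm]
      rw [hs1 n h, h4]
      omega
  set X : ℕ → ℝ → ℝ := fun n u => (m n u : ℝ) / 2 ^ n with hX
  have hXm : ∀ n, Measurable (X n) := fun n =>
    ((measurable_from_top (f := fun j : ℕ => (j : ℝ))).comp (hmm n)).div_const _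
  have hXmono : ∀ u, Monotone (fun n => X n u) := by
    intro u
    refine monotone_nat_of_le_succ fun n => ?_
    simp only [hX]
    rw [div_le_div_iff₀ (by positivity) (by positivity), pow_succ]
    have : (2 * m n u : ℝ) ≤ m (n + 1) u := by exact_mod_cast (hmstep n u).1
    have h2 : (0 : ℝ) < 2 ^ n := by positivity
    nlinarith
  have hXanti : ∀ u, Antitone (fun n => X n u + 1 / 2 ^ n) := by
    intro u
    refine antitone_nat_of_succ_le fun n => ?_
    simp only [hX]
    rw [← add_div, ← add_div, div_le_div_iff₀ (by positivity) (by positivity), pow_succ]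
    have : (m (n + 1) u : ℝ) ≤ 2 * m n u + 1 := by exact_mod_cast (hmstep n u).2
    have h2 : (0 : ℝ) < 2 ^ n := by positivity
    nlinarith
  have hXle : ∀ u i j, X i u ≤ X j u + 1 / 2 ^ j := by
    intro u i j
    rcases le_total i j with h | h
    · have h1 := hXmono u h
      have : (0 : ℝ) ≤ 1 / 2 ^ j := by positivity
      simp only at h1
      linarith
    · have h1 := hXanti u h
      have : (0 : ℝ) ≤ 1 / 2 ^ i := by positivity
      simp only at h1
      linarith
  have hbdd : ∀ u, BddAbove (Set.range fun n => X n u) := fun u =>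
    ⟨X 0 u + 1 / 2 ^ 0, by rintro _ ⟨i, rfl⟩; exact hXle u i 0⟩
  set g : ℝ → ℝ := fun u => ⨆ n, X n u with hg
  have hgm : Measurable g := Measurable.iSup hXm
  have hg1 : ∀ n u, X n u ≤ g u := fun n u => le_ciSup (hbdd u) n
  have hg2 : ∀ n u, g u ≤ X n u + 1 / 2 ^ n := fun n u => ciSup_le fun i => hXle u i n
  have hgt : ∀ u, Tendsto (fun n => X n u) atTop (nhds (g u)) := fun u =>
    tendsto_atTop_ciSup (hXmono u) (hbdd u)
  have hgcell : ∀ n u, g u ∈ Set.Icc ((s n (fl n u) : ℝ) / 2 ^ n) (((s n (fl n u) : ℝ) + 1) / 2 ^ n) := by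
    intro n u
    refine ⟨hg1 n u, ?_⟩
    rw [add_div]; exact hg2 n u
  set V : Measure ℝ := volume.restrict (Set.Ico (0 : ℝ) 1) with hV
  have hVp : IsProbabilityMeasure V := ⟨by simp [hV]⟩
  have hmap : ∀ n, V.map (fl n) =
      ∑ k ∈ Finset.range (2 ^ a n), (ENNReal.ofReal (1 / 2 ^ a n)) • Measure.dirac k :=
    fun n => map_floor (a n)
  have hflt : ∀ᵐ u ∂V, ∀ n, fl n u < 2 ^ a n := by
    rw [hV]
    refine (ae_restrict_iff' measurableSet_Ico).2 (Filter.Eventually.of_forall fun u hu n => ?_)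
    simp only [hfl]
    rw [Nat.floor_lt (by have := hu.1; positivity)]
    push_cast
    have := hu.2
    have h2 : (0 : ℝ) < 2 ^ a n := by positivity
    nlinarith
  have hcard : ∀ n (T : Finset ℕ), T ⊆ Finset.range (2 ^ a n) →
      (V (fl n ⁻¹' (T : Set ℕ))).toReal = (T.card : ℝ) / 2 ^ a n := by
    intro n T hT
    rw [← Measure.map_apply (hflm n) (by measurability), hmap]
    simp only [Measure.coe_finsetSum, Finset.sum_apply, Measure.smul_apply, smul_eq_mul]
    have : ∀ k ∈ Finset.range (2 ^ a n), ENNReal.ofReal (1 / 2 ^ a n) *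
        (Measure.dirac k) (T : Set ℕ) = if k ∈ T then ENNReal.ofReal (1 / 2 ^ a n) else 0 := by
      intro k _
      rw [Measure.dirac_apply]
      by_cases hk : k ∈ T <;> simp [hk]
    rw [Finset.sum_congr rfl this, ← Finset.sum_filter,
      Finset.filter_mem_eq_inter, Finset.inter_eq_right.2 hT, Finset.sum_const, nsmul_eq_mul,
      ENNReal.toReal_mul, ENNReal.toReal_ofReal (by positivity), ENNReal.toReal_natCast]
    ring
  set μ : Measure ℝ := V.map g with hμ
  have hμp : IsProbabilityMeasure μ := Measure.isProbabilityMeasure_map hgm.aemeasurable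
  set En : ℕ → Set ℝ := fun n => ⋃ k ∈ Finset.range (2 ^ a n),
    Set.Icc ((s n k : ℝ) / 2 ^ n) (((s n k : ℝ) + 1) / 2 ^ n) with hEn
  have hEnc : ∀ n, IsCompact (En n) := fun n =>
    (Finset.range (2 ^ a n)).isCompact_biUnion fun k _ => isCompact_Icc
  have hEc : IsCompact (⋂ n, En n) :=
    (hEnc 0).of_isClosed_subset (isClosed_iInter fun n => (hEnc n).isClosed) (Set.iInter_subset _ 0)
  refine ⟨⋂ n, En n, μ, hEc, hμp, ?_, ?_, ?_, ?_, ?_⟩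
  · rw [hμ, Measure.map_apply hgm hEc.measurableSet,
      ← mem_ae_iff_prob_eq_one (hgm hEc.measurableSet)]
    filter_upwards [hflt] with u hu
    refine Set.mem_iInter.2 fun n => ?_
    simp only [hEn, Set.mem_iUnion, Finset.mem_range]
    exact ⟨fl n u, hu n, hgcell n u⟩
  · intro x hx n
    have := Set.mem_iInter.1 hx n
    simp only [hEn, Set.mem_iUnion, Finset.mem_range] at this
    obtain ⟨k, hk, hx⟩ := this
    exact ⟨k, hk, hx⟩
  · intro n T A hA hT hTA
    rw [← hcard n T hT, hμ, Measure.map_apply hgm hA]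
    refine ENNReal.toReal_mono (measure_ne_top _ _) (measure_mono fun u hu => ?_)
    exact hTA _ hu (hgcell n u)
  · intro n T A hA hTA
    calc (μ A).toReal ≤ (V (fl n ⁻¹' ((T ∩ Finset.range (2 ^ a n) : Finset ℕ) : Set ℕ))).toReal := by
          rw [hμ, Measure.map_apply hgm hA]
          refine ENNReal.toReal_mono (measure_ne_top _ _) (measure_mono_ae ?_)
          filter_upwards [hflt] with u hu hgu
          have h1 : fl n u ∈ T := hTA _ (hu n) ⟨g u, hgcell n u, hgu⟩
          have h2 : fl n u ∈ T ∩ Finset.range (2 ^ a n) :=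
            Finset.mem_inter.2 ⟨h1, Finset.mem_range.2 (hu n)⟩
          exact h2
      _ = ((T ∩ Finset.range (2 ^ a n)).card : ℝ) / 2 ^ a n := hcard n _ Finset.inter_subset_right
      _ ≤ _ := by
          gcongr
          exact Finset.inter_subset_left
  · intro ξ
    rw [hμ, integral_map hgm.aemeasurable (by
      exact (continuous_ech.comp (by fun_prop : Continuous fun x : ℝ => ξ * x)).aestronglyMeasurable)]
    have h1 : ∀ n, ((1 / 2 ^ a n : ℝ) : ℂ) *
        ∑ k ∈ Finset.range (2 ^ a n), ech (ξ * ((s n k : ℝ) / 2 ^ n)) = ∫ u, ech (ξ * X n u) ∂V := by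
      intro n
      have h2 : ∫ u, ech (ξ * X n u) ∂V = ∫ k, ech (ξ * ((s n k : ℝ) / 2 ^ n)) ∂(V.map (fl n)) := by
        rw [integral_map (hflm n).aemeasurable (by
          exact (measurable_from_top).aestronglyMeasurable)]
      rw [h2, hmap, integral_finsetSum_measure]
      · rw [Finset.mul_sum]
        refine Finset.sum_congr rfl fun k _ => ?_
        rw [integral_smul_measure, integral_dirac, ENNReal.toReal_ofReal (by positivity)]
        simp
      · intro k _
        refine Integrable.smul_measure ?_ ENNReal.ofReal_ne_top
        exact integrable_dirac (by simp)
    simp_rw [h1]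
    refine tendsto_integral_of_dominated_convergence (fun _ => 1) ?_ (integrable_const _) ?_ ?_
    · intro n
      exact (continuous_ech.measurable.comp ((hXm n).const_mul ξ)).aestronglyMeasurable
    · intro n; exact Eventually.of_forall fun u => (norm_ech _).le
    · refine Eventually.of_forall fun u => ?_
      exact (continuous_ech.tendsto _).comp ((hgt u).const_mul ξ)


lemma card_window (T : Finset ℕ) (s : ℕ → ℕ) (hs : Set.InjOn s T) (u : ℝ)
    (h : ∀ k ∈ T, u ≤ (s k : ℝ) ∧ (s k : ℝ) ≤ u + 5) : (T.card : ℝ) ≤ 6 := by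
  classical
  rw [← Finset.card_image_of_injOn hs]
  have hsub : (T.image s) ⊆ (Finset.Icc ⌈u⌉ (⌈u⌉ + 5)).image Int.toNat := by
    intro m hm
    obtain ⟨k, hk, rfl⟩ := Finset.mem_image.1 hm
    obtain ⟨h1, h2⟩ := h k hk
    refine Finset.mem_image.2 ⟨(s k : ℤ), ?_, by simp⟩
    rw [Finset.mem_Icc]
    constructor
    · exact Int.ceil_le.2 (by exact_mod_cast h1)
    · have h3 := Int.le_ceil u
      have : ((s k : ℤ) : ℝ) ≤ ((⌈u⌉ + 5 : ℤ) : ℝ) := by push_cast; linarith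
      exact_mod_cast this
  have h1 := (Finset.card_le_card hsub).trans Finset.card_image_le
  rw [Int.card_Icc] at h1
  have h2 : ((T.image s).card) ≤ 6 := by omega
  exact_mod_cast h2

lemma ball_bounds (α C : ℝ) (hα0 : 0 < α) (hα1 : α < 1) (hC : 0 < C)
    (φ : ℝ → ℝ) (hφpos : ∀ t : ℝ, 2 ≤ t → 0 < φ t)
    (hφmono : ∀ s t : ℝ, 2 ≤ s → s ≤ t → φ s ≤ φ t)
    (a : ℕ → ℕ) (s : ℕ → ℕ → ℕ)
    (h1 : ∀ n : ℕ, ((n : ℝ) + 1) * (2 : ℝ) ^ (α * n) ≤ C * 2 ^ (a n))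
    (h2 : ∀ n : ℕ, 3 ≤ n → (2 : ℝ) ^ (a n) ≤ C * (φ (2 ^ (n - 2)) * ((n : ℝ) + 1) * (2 : ℝ) ^ (α * n)))
    (hinj : ∀ n, Set.InjOn (s n) (Finset.range (2 ^ a n)))
    (E : Set ℝ) (μ : Measure ℝ)
    (hE : ∀ x ∈ E, ∀ n, ∃ k < 2 ^ a n, x ∈ Set.Icc ((s n k : ℝ) / 2 ^ n) (((s n k : ℝ) + 1) / 2 ^ n))
    (hlow : ∀ (n : ℕ) (T : Finset ℕ) (A : Set ℝ), MeasurableSet A → T ⊆ Finset.range (2 ^ a n) →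
        (∀ k ∈ T, Set.Icc ((s n k : ℝ) / 2 ^ n) (((s n k : ℝ) + 1) / 2 ^ n) ⊆ A) →
        (T.card : ℝ) / 2 ^ a n ≤ (μ A).toReal)
    (hup : ∀ (n : ℕ) (T : Finset ℕ) (A : Set ℝ), MeasurableSet A →
        (∀ k < 2 ^ a n, (Set.Icc ((s n k : ℝ) / 2 ^ n) (((s n k : ℝ) + 1) / 2 ^ n) ∩ A).Nonempty →
          k ∈ T) → (μ A).toReal ≤ (T.card : ℝ) / 2 ^ a n)
    (x : ℝ) (hx : x ∈ E) (r : ℝ) (hr0 : 0 < r) (hr : r < 1 / 4) :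
    1 / (32 * C) * (2 * r) ^ α / (φ (1 / (2 * r)) * Real.log (1 / (2 * r)))
            ≤ (μ (Set.Icc (x - r) (x + r))).toReal ∧
        (μ (Set.Icc (x - r) (x + r))).toReal ≤ 6 * C * (2 * r) ^ α / Real.log (1 / (2 * r)) := by
  classical
  obtain ⟨m, hm1, hm2⟩ := exists_nat_pow_near_of_lt_one (x := r) (y := 1 / 2) hr0 (by linarith)
    (by norm_num) (by norm_num)
  obtain ⟨n, rfl⟩ : ∃ n, m = n + 2 := by
    have : 2 ≤ m := by
      by_contra hcon
      have h3 : (1 / 2 : ℝ) ^ 2 ≤ (1 / 2) ^ (m + 1) :=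
        pow_le_pow_of_le_one (by norm_num) (by norm_num) (by omega)
      norm_num at h3 hm1
      linarith
    exact ⟨m - 2, by omega⟩
  set N := n + 3 with hN
  have hp : (0 : ℝ) < 2 ^ n := by positivity
  have hN8 : (2 : ℝ) ^ N = 8 * 2 ^ n := by rw [hN, pow_add]; ring
  have hm1' : 1 / (8 * 2 ^ n) < r := by
    rw [one_div_pow, hN8] at hm1; exact hm1
  have hm2' : r ≤ 1 / (4 * 2 ^ n) := by
    rw [one_div_pow, pow_add] at hm2
    refine hm2.trans (le_of_eq ?_)
    congr 1
    ring
  rw [div_lt_iff₀ (by positivity)] at hm1'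
  rw [le_div_iff₀ (by positivity)] at hm2'
  have ht1 : (2 : ℝ) * 2 ^ n ≤ 1 / (2 * r) := by
    rw [le_div_iff₀ (by positivity)]; nlinarith
  have ht2 : 1 / (2 * r) ≤ (2 : ℝ) ^ N := by
    rw [div_le_iff₀ (by positivity), hN8]; nlinarith
  have hone : (1 : ℝ) ≤ 2 ^ n := one_le_pow₀ (by norm_num)
  have hlog2 := Real.log_two_gt_d9
  have hlog2' := Real.log_two_lt_d9
  have hL1 : ((n : ℝ) + 1) * Real.log 2 ≤ Real.log (1 / (2 * r)) := by
    have := Real.log_le_log (by positivity) ht1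
    rw [Real.log_mul (by norm_num) (by positivity), Real.log_pow] at this
    linarith
  have hL2 : Real.log (1 / (2 * r)) ≤ (N : ℝ) * Real.log 2 := by
    have := Real.log_le_log (by positivity) ht2
    rwa [Real.log_pow] at this
  have hn0 : (0 : ℝ) ≤ n := Nat.cast_nonneg n
  have hNr : (N : ℝ) = n + 3 := by rw [hN]; push_cast; ring
  have hL1' : ((N : ℝ) + 1) / 8 ≤ Real.log (1 / (2 * r)) := by rw [hNr]; nlinarith
  have hL2' : Real.log (1 / (2 * r)) ≤ (N : ℝ) + 1 := by rw [hNr] at hL2 ⊢; nlinarith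
  have hLpos : 0 < Real.log (1 / (2 * r)) := by rw [hNr] at hL1'; linarith
  -- powers
  set Y : ℝ := (2 : ℝ) ^ (α * N) with hY
  have hYpos : 0 < Y := by positivity
  have hYeq : Y = ((2 : ℝ) ^ N) ^ α := by
    rw [hY, mul_comm, Real.rpow_mul (by norm_num), Real.rpow_natCast]
  have hr1 : 1 ≤ (2 * r) ^ α * Y := by
    rw [hYeq, ← Real.mul_rpow (by positivity) (by positivity)]
    apply Real.one_le_rpow _ hα0.le
    rw [hN8]; nlinarith
  have hr2 : (2 * r) ^ α * Y ≤ 4 := by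
    rw [hYeq, ← Real.mul_rpow (by positivity) (by positivity)]
    calc (2 * r * 2 ^ N) ^ α ≤ (4 : ℝ) ^ α := by
          apply Real.rpow_le_rpow (by positivity) _ hα0.le
          rw [hN8]; nlinarith
      _ ≤ (4 : ℝ) ^ (1 : ℝ) := Real.rpow_le_rpow_of_exponent_le (by norm_num) hα1.le
      _ = 4 := by norm_num
  set ρ : ℝ := (2 * r) ^ α with hρ
  have hρpos : 0 < ρ := by positivity
  set A : ℝ := 2 ^ a N with hA
  have hApos : 0 < A := by positivity
  have h1N := h1 N
  have h2N := h2 N (by omega)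
  rw [show N - 2 = n + 1 by omega] at h2N
  have hφ1 : φ (2 ^ (n + 1)) ≤ φ (1 / (2 * r)) := by
    apply hφmono
    · rw [pow_succ]; linarith
    · rw [pow_succ]; linarith
  have hφ0 : 0 < φ (2 ^ (n + 1)) := hφpos _ (by rw [pow_succ]; linarith)
  have hφ2 : 0 < φ (1 / (2 * r)) := hφ0.trans_le hφ1
  have hcell : (1 : ℝ) / 2 ^ N < r := by
    rw [hN8, div_lt_iff₀ (by positivity)]; linarith
  constructor
  · obtain ⟨k, hk, hxk⟩ := hE x hx N
    have h5 := hlow N {k} (Set.Icc (x - r) (x + r)) measurableSet_Icc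
      (by simpa using hk) (by
        intro k' hk'
        rw [Finset.mem_singleton] at hk'
        subst hk'
        rw [Set.mem_Icc, add_div] at hxk
        intro y hy
        rw [Set.mem_Icc, add_div] at hy
        rw [Set.mem_Icc]
        constructor <;> linarith [hy.1, hy.2, hxk.1, hxk.2])
    refine le_trans ?_ h5
    rw [Finset.card_singleton, Nat.cast_one, div_le_div_iff₀ (by positivity) (by positivity)]
    calc 1 / (32 * C) * ρ * A
        ≤ 1 / (32 * C) * ρ * (C * (φ (2 ^ (n + 1)) * ((N : ℝ) + 1) * Y)) := by gcongr
      _ = (ρ * Y) * (φ (2 ^ (n + 1)) * (((N : ℝ) + 1) / 8)) / 4 := by field_simp; ring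
      _ ≤ 4 * (φ (1 / (2 * r)) * Real.log (1 / (2 * r))) / 4 := by gcongr
      _ = _ := by ring
  · set T := (Finset.range (2 ^ a N)).filter
      (fun k => (Set.Icc ((s N k : ℝ) / 2 ^ N) (((s N k : ℝ) + 1) / 2 ^ N) ∩ Set.Icc (x - r) (x + r)).Nonempty) with hT
    have h5 := hup N T (Set.Icc (x - r) (x + r)) measurableSet_Icc (by
      intro k hk hne
      rw [hT, Finset.mem_filter, Finset.mem_range]
      exact ⟨hk, hne⟩)
    have h6 : (T.card : ℝ) ≤ 6 := by
      apply card_window T (s N) ((hinj N).mono (by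
        intro k hk; exact_mod_cast (Finset.mem_filter.1 hk).1)) ((x - r) * 2 ^ N - 1)
      intro k hk
      obtain ⟨y, hy1, hy2⟩ := (Finset.mem_filter.1 hk).2
      rw [Set.mem_Icc, div_le_iff₀ (by positivity), le_div_iff₀ (by positivity)] at hy1
      rw [Set.mem_Icc] at hy2
      have hp2 : (0 : ℝ) < 2 ^ N := by positivity
      have e1 : (x - r) * 2 ^ N ≤ y * 2 ^ N := by gcongr; exact hy2.1
      have e2 : y * 2 ^ N ≤ (x + r) * 2 ^ N := by gcongr; exact hy2.2
      have e3 : r * 2 ^ N ≤ 2 := by rw [hN8]; nlinarith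
      constructor <;> linarith [hy1.1, hy1.2]
    refine h5.trans ?_
    calc (T.card : ℝ) / A ≤ 6 / A := by gcongr
      _ ≤ _ := by
        rw [div_le_div_iff₀ hApos hLpos]
        calc 6 * Real.log (1 / (2 * r)) ≤ 6 * ((N : ℝ) + 1) := by gcongr
          _ = 6 * ((N : ℝ) + 1) * 1 := by ring
          _ ≤ 6 * ((N : ℝ) + 1) * (ρ * Y) := by gcongr
          _ = 6 * ρ * (((N : ℝ) + 1) * Y) := by ring
          _ ≤ 6 * ρ * (C * A) := by gcongr
          _ = _ := by ring


noncomputable def kap (η : ℝ) : ℂ := (1 - ech η) / (2 * (Real.pi : ℂ) * Complex.I * (η : ℂ))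

lemma norm_den (η : ℝ) : ‖2 * (Real.pi : ℂ) * Complex.I * (η : ℂ)‖ = 2 * Real.pi * |η| := by
  simp [abs_of_pos Real.pi_pos]

lemma norm_kap_le_one (η : ℝ) (hη : η ≠ 0) : ‖kap η‖ ≤ 1 := by
  have : 0 < |η| := abs_pos.2 hη
  have hpi := Real.pi_pos
  rw [kap, norm_div, norm_den, div_le_one (by positivity), norm_sub_rev]
  exact norm_ech_sub_one_le η

lemma norm_one_sub_ech (η : ℝ) : ‖1 - ech η‖ ≤ 2 := by
  calc ‖1 - ech η‖ ≤ ‖(1 : ℂ)‖ + ‖ech η‖ := norm_sub_le _ _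
    _ = 2 := by rw [norm_ech]; norm_num

lemma norm_kap_le (η : ℝ) (hη : η ≠ 0) : ‖kap η‖ ≤ 1 / |η| := by
  have : 0 < |η| := abs_pos.2 hη
  have hpi := Real.pi_gt_three
  rw [kap, norm_div, norm_den, div_le_div_iff₀ (by positivity) this]
  have := norm_one_sub_ech η
  nlinarith

lemma kap_two (η : ℝ) (hη : η ≠ 0) : kap (2 * η) = kap η * ((1 + ech η) / 2) := by
  have h1 : ech (2 * η) = ech η * ech η := by rw [two_mul, ech_add]
  have h2 : (η : ℂ) ≠ 0 := by exact_mod_cast hη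
  have h3 : (Real.pi : ℂ) ≠ 0 := by exact_mod_cast Real.pi_pos.ne'
  have h4 := Complex.I_ne_zero
  rw [kap, kap, h1]
  push_cast
  field_simp
  ring

lemma kap_tendsto (ξ : ℝ) (hξ : ξ ≠ 0) : Tendsto (fun n : ℕ => kap (ξ / 2 ^ n)) atTop (nhds 1) := by
  have h1 := (Complex.hasDerivAt_exp 0).tendsto_slope_zero
  have h0 : Tendsto (fun n : ℕ => ξ / 2 ^ n) atTop (nhds 0) := by
    have := (tendsto_pow_atTop_nhds_zero_of_lt_one (r := (1/2 : ℝ)) (by norm_num) (by norm_num)).const_mul ξ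
    rw [mul_zero] at this
    refine this.congr (fun n => ?_)
    rw [one_div_pow]; ring
  have h2 : Tendsto (fun n : ℕ => -(2 * (Real.pi : ℂ) * Complex.I * ((ξ / 2 ^ n : ℝ) : ℂ))) atTop
      (nhdsWithin 0 {0}ᶜ) := by
    rw [tendsto_nhdsWithin_iff]
    constructor
    · have h3 : Tendsto (fun n : ℕ => ((ξ / 2 ^ n : ℝ) : ℂ)) atTop (nhds 0) := by
        have := (Complex.continuous_ofReal.tendsto 0).comp h0
        rw [Complex.ofReal_zero] at this
        exact this
      have := (h3.const_mul (2 * (Real.pi : ℂ) * Complex.I)).neg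
      simpa using this
    · refine Eventually.of_forall (fun n => ?_)
      have h3 : (Real.pi : ℂ) ≠ 0 := by exact_mod_cast Real.pi_pos.ne'
      have h4 := Complex.I_ne_zero
      have h5 : ((ξ / 2 ^ n : ℝ) : ℂ) ≠ 0 := by
        have : ξ / 2 ^ n ≠ 0 := by positivity
        exact_mod_cast this
      simp only [Set.mem_compl_iff, Set.mem_singleton_iff, neg_eq_zero]
      exact mul_ne_zero (mul_ne_zero (mul_ne_zero two_ne_zero h3) h4) h5
  have h3 := h1.comp h2
  rw [Complex.exp_zero] at h3
  refine h3.congr (fun n => ?_)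
  simp only [Function.comp, zero_add, smul_eq_mul, kap, ech]
  rw [inv_mul_eq_div, div_neg, ← neg_div, neg_sub]

lemma sum_range_two_mul (f : ℕ → ℂ) (N : ℕ) :
    ∑ k ∈ Finset.range (2 * N), f k = ∑ k ∈ Finset.range N, (f (2 * k) + f (2 * k + 1)) := by
  induction N with
  | zero => simp
  | succ n ih => rw [Finset.sum_range_succ, ← ih, Nat.mul_succ, Finset.sum_range_succ, Finset.sum_range_succ, add_assoc]

noncomputable def Phi (a : ℕ → ℕ) (s : ℕ → ℕ → ℕ) (ξ : ℝ) (n : ℕ) : ℂ :=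
  ((1 / 2 ^ a n : ℝ) : ℂ) * (∑ k ∈ Finset.range (2 ^ a n), ech (ξ * ((s n k : ℝ) / 2 ^ n))) * kap (ξ / 2 ^ n)

lemma Phi_step (a : ℕ → ℕ) (s e : ℕ → ℕ → ℕ)
    (ha : ∀ n, a (n + 1) = a n ∨ a (n + 1) = a n + 1)
    (hs1 : ∀ n, a (n + 1) ≠ a n → ∀ k, s (n + 1) k = 2 * s n (k / 2) + k % 2)
    (hs2 : ∀ n, a (n + 1) = a n → ∀ k, s (n + 1) k = 2 * s n k + e n k)
    (he : ∀ n k, e n k ≤ 1) (B : ℕ → ℝ)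
    (hB : ∀ (n : ℕ) (θ : ℝ), ‖∑ k ∈ Finset.range (2 ^ a n), ((1 - 2 * (e n k : ℝ) : ℝ) : ℂ) * ech (θ * s n k)‖ ≤ B n)
    (ξ : ℝ) (hξ : ξ ≠ 0) (n : ℕ) :
    ‖Phi a s ξ (n + 1) - Phi a s ξ n‖ ≤ min 1 (2 ^ (n + 1) / |ξ|) * (B n / 2 ^ a n) := by
  set η := ξ / 2 ^ (n + 1) with hη
  have hη0 : η ≠ 0 := by positivity
  have h2η : ξ / 2 ^ n = 2 * η := by rw [hη, pow_succ]; field_simp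
  have hB0 : 0 ≤ B n := (norm_nonneg _).trans (hB n 0)
  have hmin : 0 ≤ min 1 (2 ^ (n + 1) / |ξ|) := by positivity
  have hk2 := kap_two η hη0
  by_cases h : a (n + 1) = a n
  · have key : Phi a s ξ (n + 1) - Phi a s ξ n = (kap η * ((1 - ech η) / 2)) *
        (((1 / 2 ^ a n : ℝ) : ℂ) * ∑ k ∈ Finset.range (2 ^ a n), ((1 - 2 * (e n k : ℝ) : ℝ) : ℂ) * ech (2 * η * s n k)) := by
      have hterm : ∀ k, ech (ξ * ((s (n + 1) k : ℝ) / 2 ^ (n + 1))) =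
          ech (2 * η * s n k) * ((1 + ech η) / 2) +
            ((1 - 2 * (e n k : ℝ) : ℝ) : ℂ) * ech (2 * η * s n k) * ((1 - ech η) / 2) := by
        intro k
        rw [hs2 n h]
        have : ξ * (((2 * s n k + e n k : ℕ) : ℝ) / 2 ^ (n + 1)) = 2 * η * s n k + η * e n k := by
          rw [hη]; push_cast; ring
        rw [this, ech_add]
        have h01 : e n k = 0 ∨ e n k = 1 := by have := he n k; omega
        rcases h01 with h0 | h0 <;> rw [h0]
        · simp [ech_zero]; ring
        · simp; ring
      have hterm2 : ∀ k, ech (ξ * ((s n k : ℝ) / 2 ^ n)) = ech (2 * η * s n k) := by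
        intro k; rw [← h2η]; congr 1; ring
      unfold Phi
      rw [h, h2η, hk2, ← hη]
      simp only [hterm, hterm2, Finset.sum_add_distrib, ← Finset.sum_mul]
      ring
    rw [key, norm_mul, norm_mul, norm_mul, Complex.norm_real, Real.norm_of_nonneg (by positivity)]
    have e1 : ‖kap η‖ * ‖(1 - ech η) / 2‖ ≤ min 1 (2 ^ (n + 1) / |ξ|) := by
      have e2 : ‖(1 - ech η) / 2‖ ≤ 1 := by
        rw [norm_div]; have := norm_one_sub_ech η; norm_num; linarith
      have e3 : ‖kap η‖ ≤ min 1 (2 ^ (n + 1) / |ξ|) := by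
        refine le_min (norm_kap_le_one η hη0) ((norm_kap_le η hη0).trans (le_of_eq ?_))
        rw [hη, abs_div, abs_of_pos (by positivity : (0 : ℝ) < 2 ^ (n + 1)), one_div_div]
      calc _ ≤ min 1 (2 ^ (n + 1) / |ξ|) * 1 := mul_le_mul e3 e2 (norm_nonneg _) hmin
        _ = _ := mul_one _
    refine mul_le_mul e1 ?_ (by positivity) hmin
    rw [one_div_mul_eq_div]
    gcongr
    exact hB n (2 * η)
  · have h3 := (ha n).resolve_left h
    have : Phi a s ξ (n + 1) = Phi a s ξ n := by
      unfold Phi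
      rw [h2η, hk2, ← hη, h3, pow_succ' (2 : ℕ), sum_range_two_mul]
      have hterm : ∀ k, ech (ξ * ((s (n + 1) (2 * k) : ℝ) / 2 ^ (n + 1))) +
          ech (ξ * ((s (n + 1) (2 * k + 1) : ℝ) / 2 ^ (n + 1))) =
          ech (ξ * ((s n k : ℝ) / 2 ^ n)) * (1 + ech η) := by
        intro k
        rw [hs1 n h, hs1 n h, show 2 * k / 2 = k by omega, show 2 * k % 2 = 0 by omega,
          show (2 * k + 1) / 2 = k by omega, show (2 * k + 1) % 2 = 1 by omega]
        have e1 : ξ * (((2 * s n k + 0 : ℕ) : ℝ) / 2 ^ (n + 1)) = ξ * ((s n k : ℝ) / 2 ^ n) := by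
          push_cast; rw [pow_succ]; field_simp; ring
        have e2 : ξ * (((2 * s n k + 1 : ℕ) : ℝ) / 2 ^ (n + 1)) = ξ * ((s n k : ℝ) / 2 ^ n) + η := by
          rw [hη]; push_cast; rw [pow_succ]; field_simp
        rw [e1, e2, ech_add]; ring
      simp only [hterm, ← Finset.sum_mul]
      push_cast
      rw [pow_succ (2 : ℂ)]
      field_simp
    rw [this, sub_self, norm_zero]
    positivity

lemma geo_sum (ρ : ℝ) (h1 : 1 < 2 * ρ) (h2 : ρ < 1) (M N : ℕ) :
    ∑ n ∈ Finset.range N, min 1 ((2 : ℝ) ^ (n + 1) / 2 ^ M) * ρ ^ n ≤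
      (2 / (2 * ρ - 1) + 1 / (1 - ρ)) * ρ ^ M := by
  have hρ : 0 < ρ := by linarith
  calc _ ≤ ∑ n ∈ Finset.range (M + N), min 1 ((2 : ℝ) ^ (n + 1) / 2 ^ M) * ρ ^ n := by
        apply Finset.sum_le_sum_of_subset_of_nonneg
        · intro k; simp only [Finset.mem_range]; omega
        · intros; positivity
    _ = ∑ n ∈ Finset.range M, min 1 ((2 : ℝ) ^ (n + 1) / 2 ^ M) * ρ ^ n +
        ∑ j ∈ Finset.range N, min 1 ((2 : ℝ) ^ (M + j + 1) / 2 ^ M) * ρ ^ (M + j) := by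
        rw [Finset.sum_range_add]
    _ ≤ ∑ n ∈ Finset.range M, (2 / 2 ^ M) * (2 * ρ) ^ n + ∑ j ∈ Finset.range N, ρ ^ M * ρ ^ j := by
        refine add_le_add (Finset.sum_le_sum fun n _ => ?_) (Finset.sum_le_sum fun j _ => ?_)
        · calc _ ≤ ((2 : ℝ) ^ (n + 1) / 2 ^ M) * ρ ^ n := by
                gcongr; exact min_le_right _ _
            _ = _ := by rw [mul_pow, pow_succ]; ring
        · calc _ ≤ 1 * ρ ^ (M + j) := by
                gcongr; exact min_le_left _ _
            _ = _ := by rw [one_mul, pow_add]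
    _ ≤ 2 / (2 * ρ - 1) * ρ ^ M + 1 / (1 - ρ) * ρ ^ M := by
        rw [← Finset.mul_sum, ← Finset.mul_sum, geom_sum_eq (by linarith), geom_sum_eq (by linarith)]
        refine add_le_add ?_ ?_
        · have : (2 * ρ) ^ M - 1 ≤ 2 ^ M * ρ ^ M := by rw [mul_pow]; linarith
          calc 2 / 2 ^ M * (((2 * ρ) ^ M - 1) / (2 * ρ - 1)) ≤
              2 / 2 ^ M * ((2 ^ M * ρ ^ M) / (2 * ρ - 1)) := by
                have : 0 < 2 * ρ - 1 := by linarith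
                gcongr
            _ = _ := by field_simp
        · have e : (ρ ^ N - 1) / (ρ - 1) = (1 - ρ ^ N) / (1 - ρ) := by
            rw [← neg_sub, ← neg_sub 1 ρ, neg_div_neg_eq]
          have : 0 < 1 - ρ := by linarith
          rw [e, mul_comm]
          gcongr
          have : 0 < ρ ^ N := by positivity
          linarith
    _ = _ := by ring

lemma decay (α β C : ℝ) (hβ0 : 0 < β) (hβα : β ≤ α) (hα1 : α < 1) (hC : 0 < C)
    (a b : ℕ → ℕ) (s e : ℕ → ℕ → ℕ) (ha0 : a 0 = 0) (hs0 : ∀ k, s 0 k = 0)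
    (ha : ∀ n, a (n + 1) = a n ∨ a (n + 1) = a n + 1)
    (hs1 : ∀ n, a (n + 1) ≠ a n → ∀ k, s (n + 1) k = 2 * s n (k / 2) + k % 2)
    (hs2 : ∀ n, a (n + 1) = a n → ∀ k, s (n + 1) k = 2 * s n k + e n k)
    (he : ∀ n k, e n k ≤ 1)
    (h1 : ∀ n : ℕ, ((n : ℝ) + 1) * (2 : ℝ) ^ (α * n) ≤ C * 2 ^ (a n))
    (h3 : ∀ n : ℕ, (2 : ℝ) ^ (b n) * (2 : ℝ) ^ (β / 2 * n) ≤ C * 2 ^ (a n))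
    (hB : ∀ (n : ℕ) (θ : ℝ), ‖∑ k ∈ Finset.range (2 ^ a n), ((1 - 2 * (e n k : ℝ) : ℝ) : ℂ) * ech (θ * s n k)‖
      ≤ 20 * Real.sqrt (2 ^ a n * (n + 1)) + 2 ^ b n)
    (μ : Measure ℝ) [IsProbabilityMeasure μ]
    (hμ : ∀ ξ : ℝ, Tendsto (fun n => ((1 / 2 ^ a n : ℝ) : ℂ) *
        ∑ k ∈ Finset.range (2 ^ a n), ech (ξ * ((s n k : ℝ) / 2 ^ n))) atTop
        (nhds (∫ x, ech (ξ * x) ∂μ))) :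
    ∃ C' : ℝ, 0 < C' ∧ ∀ ξ : ℝ, ξ ≠ 0 → ‖∫ x, ech (ξ * x) ∂μ‖ ≤ C' * |ξ| ^ (-(β / 2)) := by
  set ρ : ℝ := (2 : ℝ) ^ (-(β / 2)) with hρ
  have hρ0 : 0 < ρ := by positivity
  have hρ1 : ρ < 1 := Real.rpow_lt_one_of_one_lt_of_neg (by norm_num) (by linarith)
  have hρ2 : 1 < 2 * ρ := by
    have : 2 * ρ = (2 : ℝ) ^ (1 - β / 2) := by
      rw [hρ, sub_eq_add_neg, Real.rpow_add (by norm_num), Real.rpow_one]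
    rw [this]
    exact Real.one_lt_rpow (by norm_num) (by linarith)
  have hρn : ∀ n : ℕ, ρ ^ n = (2 : ℝ) ^ (-(β / 2) * n) := by
    intro n; rw [hρ, Real.rpow_mul (by norm_num), Real.rpow_natCast]
  set K : ℝ := 20 * Real.sqrt C + C with hK
  have hK0 : 0 < K := by positivity
  have hBn : ∀ n : ℕ, (20 * Real.sqrt (2 ^ a n * (n + 1)) + 2 ^ b n) / 2 ^ a n ≤ K * ρ ^ n := by
    intro n
    have hA : (0 : ℝ) < 2 ^ a n := by positivity
    rw [div_le_iff₀ hA]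
    have hr : ρ ^ n * (2 : ℝ) ^ (β / 2 * n) = 1 := by
      rw [hρn, ← Real.rpow_add (by norm_num)]
      simp
    have e1 : (2 : ℝ) ^ b n ≤ C * ρ ^ n * 2 ^ a n := by
      calc (2 : ℝ) ^ b n = ρ ^ n * (2 ^ b n * (2 : ℝ) ^ (β / 2 * n)) := by
            rw [mul_left_comm, hr, mul_one]
        _ ≤ ρ ^ n * (C * 2 ^ a n) := mul_le_mul_of_nonneg_left (h3 n) (by positivity)
        _ = _ := by ring
    have e2 : Real.sqrt (2 ^ a n * (n + 1)) ≤ Real.sqrt C * (ρ ^ n * 2 ^ a n) := by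
      have : Real.sqrt C * (ρ ^ n * 2 ^ a n) = Real.sqrt (C * (ρ ^ n * 2 ^ a n) ^ 2) := by
        rw [Real.sqrt_mul hC.le, Real.sqrt_sq (by positivity)]
      rw [this]
      apply Real.sqrt_le_sqrt
      have e3 : ((n : ℝ) + 1) * ((2 : ℝ) ^ (β / 2 * n)) ^ 2 ≤ C * 2 ^ a n := by
        refine le_trans ?_ (h1 n)
        gcongr
        rw [← Real.rpow_natCast, ← Real.rpow_mul (by norm_num)]
        apply Real.rpow_le_rpow_of_exponent_le (by norm_num)
        push_cast
        have : (0 : ℝ) ≤ n := Nat.cast_nonneg n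
        nlinarith
      calc (2 : ℝ) ^ a n * (n + 1) = 2 ^ a n * (n + 1) * (ρ ^ n * (2 : ℝ) ^ (β / 2 * n)) ^ 2 := by
            rw [hr]; ring
        _ = 2 ^ a n * (ρ ^ n) ^ 2 * (((n : ℝ) + 1) * ((2 : ℝ) ^ (β / 2 * n)) ^ 2) := by ring
        _ ≤ 2 ^ a n * (ρ ^ n) ^ 2 * (C * 2 ^ a n) := by gcongr
        _ = _ := by ring
    rw [hK]
    nlinarith
  set G : ℝ := 2 / (2 * ρ - 1) + 1 / (1 - ρ) with hG
  have hG0 : 0 < G := by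
    have := sub_pos.2 hρ2
    have := sub_pos.2 hρ1
    positivity
  refine ⟨1 + K * G * 2, by positivity, fun ξ hξ => ?_⟩
  have hξ0 : 0 < |ξ| := abs_pos.2 hξ
  rcases lt_or_ge |ξ| 1 with hlt | hge
  · have e1 : ‖∫ x, ech (ξ * x) ∂μ‖ ≤ 1 := by
      have := norm_integral_le_of_norm_le_const (μ := μ) (f := fun x => ech (ξ * x)) (C := 1)
        (Eventually.of_forall fun x => (norm_ech _).le)
      simpa using this
    have e2 : 1 ≤ |ξ| ^ (-(β / 2)) := Real.one_le_rpow_of_pos_of_le_one_of_nonpos hξ0 hlt.le (by linarith)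
    have : 0 < K * G * 2 := by positivity
    nlinarith
  · obtain ⟨M, hM1, hM2⟩ := exists_nat_pow_near (x := |ξ|) (y := 2) hge (by norm_num)
    have hP0 : ‖Phi a s ξ 0‖ ≤ 1 / |ξ| := by
      have : Phi a s ξ 0 = kap ξ := by
        unfold Phi; simp [ha0, hs0, ech_zero]
      rw [this]; exact norm_kap_le ξ hξ
    have hPN : ∀ N, ‖Phi a s ξ N‖ ≤ 1 / |ξ| + K * ∑ n ∈ Finset.range N, min 1 ((2 : ℝ) ^ (n + 1) / 2 ^ M) * ρ ^ n := by
      intro N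
      induction N with
      | zero => simpa using hP0
      | succ n ih =>
        have h4 := Phi_step a s e ha hs1 hs2 he _ hB ξ hξ n
        have h5 : min 1 ((2 : ℝ) ^ (n + 1) / |ξ|) * ((20 * Real.sqrt (2 ^ a n * (n + 1)) + 2 ^ b n) / 2 ^ a n)
            ≤ min 1 ((2 : ℝ) ^ (n + 1) / 2 ^ M) * (K * ρ ^ n) := by
          have := hBn n
          gcongr
        have h6 : ‖Phi a s ξ (n + 1)‖ ≤ ‖Phi a s ξ (n + 1) - Phi a s ξ n‖ + ‖Phi a s ξ n‖ := by
          have := norm_add_le (Phi a s ξ (n + 1) - Phi a s ξ n) (Phi a s ξ n)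
          rwa [sub_add_cancel] at this
        rw [Finset.sum_range_succ]
        linarith
    have hbd : ∀ N, ‖Phi a s ξ N‖ ≤ (1 + K * G * 2) * |ξ| ^ (-(β / 2)) := by
      intro N
      refine (hPN N).trans ?_
      have g1 := geo_sum ρ hρ2 hρ1 M N
      rw [← hG] at g1
      have g2 : 1 / |ξ| ≤ |ξ| ^ (-(β / 2)) := by
        rw [one_div, ← Real.rpow_neg_one]
        exact Real.rpow_le_rpow_of_exponent_le hge (by linarith)
      have g3 : ρ ^ M ≤ 2 * |ξ| ^ (-(β / 2)) := by
        have : ρ ^ (M + 1) ≤ |ξ| ^ (-(β / 2)) := by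
          have e : ρ ^ (M + 1) = ((2 : ℝ) ^ (M + 1)) ^ (-(β / 2)) := by
            rw [hρ, ← Real.rpow_natCast, ← Real.rpow_natCast, ← Real.rpow_mul (by norm_num),
              ← Real.rpow_mul (by norm_num), mul_comm]
          rw [e]
          exact Real.rpow_le_rpow_of_nonpos hξ0 hM2.le (by linarith)
        rw [pow_succ] at this
        have : 0 < ρ ^ M := by positivity
        nlinarith
      calc _ ≤ |ξ| ^ (-(β / 2)) + K * (G * (2 * |ξ| ^ (-(β / 2)))) := by
            gcongr
            exact g1.trans (by gcongr)
        _ = _ := by ring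
    have hlim := (hμ ξ).mul (kap_tendsto ξ hξ)
    rw [mul_one] at hlim
    exact le_of_tendsto hlim.norm (Eventually.of_forall hbd)


lemma conj_ech (θ : ℝ) : (starRingEnd ℂ) (ech θ) = ech (-θ) := by
  rw [ech_eq, ech_eq, ← Complex.exp_conj]
  congr 1
  rw [map_mul, Complex.conj_I, Complex.conj_ofReal]
  push_cast
  ring

lemma gauss_one (w : ℝ) : ∫ v : ℝ, ech (w * v) * (Real.exp (-Real.pi * v ^ 2) : ℂ) = (Real.exp (-Real.pi * w ^ 2) : ℂ) := by
  have h := congrFun (fourier_gaussian_pi (b := 1) (by simp)) w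
  rw [Real.fourier_real_eq_integral_exp_smul] at h
  simp only [Complex.one_cpow, div_one, one_mul, mul_one, smul_eq_mul] at h
  push_cast at h ⊢
  rw [← h]
  congr 1
  ext v
  rw [ech]
  congr 2
  push_cast; ring

lemma gauss_D (D : ℝ) (hD : 0 < D) (y : ℝ) :
    ∫ ξ : ℝ, ech (y * ξ) * (Real.exp (-Real.pi * (ξ / D) ^ 2) : ℂ) =
      ((D * Real.exp (-Real.pi * (D * y) ^ 2) : ℝ) : ℂ) := by
  have h := Measure.integral_comp_div (fun u : ℝ => ech ((D * y) * u) * (Real.exp (-Real.pi * u ^ 2) : ℂ)) D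
  rw [gauss_one, abs_of_pos hD] at h
  rw [Complex.ofReal_mul, ← Complex.real_smul, ← h]
  congr 1
  ext ξ
  congr 2
  field_simp

lemma integrable_gauss (D : ℝ) (hD : 0 < D) :
    Integrable (fun ξ : ℝ => Real.exp (-Real.pi * (ξ / D) ^ 2)) volume := by
  have := integrable_exp_neg_mul_sq (b := Real.pi / D ^ 2) (by have := Real.pi_pos; positivity)
  refine this.congr (Eventually.of_forall fun ξ => ?_)
  show Real.exp _ = Real.exp _
  congr 1
  field_simp

/-- the testing density -/
noncomputable def Hh (D : ℝ) (Q : Finset ℕ) (ξ : ℝ) : ℝ :=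
  D⁻¹ * Real.exp (-Real.pi * (ξ / D) ^ 2) * ((Q.card : ℝ)⁻¹ * ‖∑ s ∈ Q, ech (((s : ℝ) / D) * ξ)‖ ^ 2)

lemma Hh_nonneg (D : ℝ) (hD : 0 < D) (Q : Finset ℕ) (ξ : ℝ) : 0 ≤ Hh D Q ξ := by
  unfold Hh; positivity

lemma Hh_le_gauss (D : ℝ) (hD : 0 < D) (Q : Finset ℕ) (ξ : ℝ) :
    Hh D Q ξ ≤ (Q.card / D) * Real.exp (-Real.pi * (ξ / D) ^ 2) := by
  unfold Hh
  have h1 : ‖∑ s ∈ Q, ech (((s : ℝ) / D) * ξ)‖ ≤ Q.card := by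
    refine (norm_sum_le _ _).trans ?_
    simp [norm_ech]
  have h2 : (Q.card : ℝ)⁻¹ * ‖∑ s ∈ Q, ech (((s : ℝ) / D) * ξ)‖ ^ 2 ≤ Q.card := by
    calc _ ≤ (Q.card : ℝ)⁻¹ * (Q.card : ℝ) ^ 2 := by gcongr
      _ = Q.card := by
        rcases eq_or_ne (Q.card : ℝ) 0 with h | h
        · rw [h]; simp
        · field_simp
  calc _ ≤ D⁻¹ * Real.exp (-Real.pi * (ξ / D) ^ 2) * Q.card := by gcongr
    _ = _ := by ring

lemma Hh_le (D : ℝ) (hD : 0 < D) (Q : Finset ℕ) (ξ : ℝ) : Hh D Q ξ ≤ Q.card / D := by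
  refine (Hh_le_gauss D hD Q ξ).trans ?_
  have : Real.exp (-Real.pi * (ξ / D) ^ 2) ≤ 1 := by
    rw [Real.exp_le_one_iff]
    have := Real.pi_pos
    have : 0 ≤ Real.pi * (ξ / D) ^ 2 := by positivity
    linarith
  exact mul_le_of_le_one_right (by positivity) this

lemma Hh_continuous (D : ℝ) (Q : Finset ℕ) : Continuous (Hh D Q) := by
  unfold Hh
  have := continuous_ech
  fun_prop

lemma Hh_integrable (D : ℝ) (hD : 0 < D) (Q : Finset ℕ) : Integrable (Hh D Q) volume := by
  refine ((integrable_gauss D hD).const_mul (Q.card / D)).mono' (Hh_continuous D Q).aestronglyMeasurable ?_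
  refine Eventually.of_forall fun ξ => ?_
  rw [Real.norm_of_nonneg (Hh_nonneg D hD Q ξ)]
  exact Hh_le_gauss D hD Q ξ

/-- the Fourier transform of the testing density -/
noncomputable def HH (D : ℝ) (Q : Finset ℕ) (x : ℝ) : ℝ :=
  (Q.card : ℝ)⁻¹ * ∑ s ∈ Q, ∑ t ∈ Q, Real.exp (-Real.pi * (D * x + s - t) ^ 2)

lemma HH_eq (D : ℝ) (hD : 0 < D) (Q : Finset ℕ) (x : ℝ) :
    ∫ ξ : ℝ, (Hh D Q ξ) • ech (ξ * x) = ((HH D Q x : ℝ) : ℂ) := by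
  have h1 : ∀ ξ : ℝ, (Hh D Q ξ) • ech (ξ * x) = ∑ s ∈ Q, ∑ t ∈ Q,
      ((D⁻¹ * (Q.card : ℝ)⁻¹ : ℝ) : ℂ) * (ech ((x + s / D - t / D) * ξ) * (Real.exp (-Real.pi * (ξ / D) ^ 2) : ℂ)) := by
    intro ξ
    have h2 : ((‖∑ s ∈ Q, ech (((s : ℝ) / D) * ξ)‖ ^ 2 : ℝ) : ℂ) =
        ∑ s ∈ Q, ∑ t ∈ Q, ech (((s : ℝ) / D) * ξ) * ech (-(((t : ℝ) / D) * ξ)) := by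
      push_cast
      rw [← Complex.mul_conj', map_sum, Finset.sum_mul_sum]
      simp only [conj_ech]
    rw [Complex.real_smul, Hh]
    rw [Complex.ofReal_mul, Complex.ofReal_mul _ (_ ^ 2), h2]
    simp only [Finset.mul_sum, Finset.sum_mul]
    refine Finset.sum_congr rfl fun s _ => Finset.sum_congr rfl fun t _ => ?_
    rw [show (x + s / D - t / D) * ξ = (s / D) * ξ + (-((t / D) * ξ)) + ξ * x by ring, ech_add, ech_add]
    push_cast
    ring
  have h_int : ∀ s t : ℕ, Integrable (fun ξ : ℝ => ((D⁻¹ * (Q.card : ℝ)⁻¹ : ℝ) : ℂ) *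
      (ech ((x + s / D - t / D) * ξ) * (Real.exp (-Real.pi * (ξ / D) ^ 2) : ℂ))) volume := by
    intro s t
    apply Integrable.const_mul
    refine (integrable_gauss D hD).mono' ?_ (Eventually.of_forall fun ξ => ?_)
    · have := continuous_ech
      exact Continuous.aestronglyMeasurable (by fun_prop)
    · rw [norm_mul, norm_ech, one_mul, Complex.norm_real, Real.norm_of_nonneg (by positivity)]
  simp only [h1]
  rw [integral_finsetSum _ fun s _ => integrable_finsetSum _ fun t _ => h_int s t]
  unfold HH
  rw [Finset.mul_sum]
  push_cast
  refine Finset.sum_congr rfl fun s _ => ?_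
  rw [integral_finsetSum _ fun t _ => by simpa using h_int s t, Finset.mul_sum]
  refine Finset.sum_congr rfl fun t _ => ?_
  rw [integral_const_mul]
  have := gauss_D D hD (x + s / D - t / D)
  push_cast at this
  rw [this]
  have e : D * (x + s / D - t / D) = D * x + s - t := by field_simp
  have e' : (D : ℂ) * (x + s / D - t / D) = D * x + s - t := by
    exact_mod_cast e
  rw [e']
  have hD' : (D : ℂ) ≠ 0 := by exact_mod_cast hD.ne'
  field_simp

lemma gauss_half (s t : ℕ) : Real.exp (-Real.pi * ((s : ℝ) - t) ^ 2) ≤ (1 / 2) ^ (s - t) * (1/2) ^ (t - s) := by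
  have key : ∀ k : ℕ, Real.exp (-Real.pi * (k : ℝ) ^ 2) ≤ (1 / 2) ^ k := by
    intro k
    have h1 : (1 / 2 : ℝ) ^ k = Real.exp (-(Real.log 2 * k)) := by
      rw [one_div, inv_pow, Real.exp_neg, Real.exp_mul, Real.exp_log (by norm_num), Real.rpow_natCast]
    rw [h1, Real.exp_le_exp]
    have hk : (k : ℝ) ≤ (k : ℝ) ^ 2 := by
      have : k ≤ k ^ 2 := Nat.le_self_pow (by norm_num) k
      exact_mod_cast this
    have := Real.pi_gt_three
    have := Real.log_two_lt_d9
    have : (0 : ℝ) ≤ k := Nat.cast_nonneg k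
    nlinarith
  rcases le_total s t with h | h
  · rw [Nat.sub_eq_zero_of_le h, pow_zero, one_mul]
    have := key (t - s)
    rw [Nat.cast_sub h] at this
    rwa [show ((s : ℝ) - t) ^ 2 = ((t : ℝ) - s) ^ 2 by ring]
  · rw [Nat.sub_eq_zero_of_le h, pow_zero, mul_one]
    have := key (s - t)
    rwa [Nat.cast_sub h] at this

lemma half_sum (A : Finset ℕ) : ∑ k ∈ A, (1 / 2 : ℝ) ^ k ≤ 2 := by
  have := summable_geometric_two.sum_le_tsum A (fun i _ => by positivity)
  rwa [tsum_geometric_two] at this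

lemma gauss_row (Q : Finset ℕ) (s : ℕ) : ∑ t ∈ Q, Real.exp (-Real.pi * ((s : ℝ) - t) ^ 2) ≤ 4 := by
  classical
  have h1 : ∑ t ∈ Q.filter (fun t => t ≤ s), Real.exp (-Real.pi * ((s : ℝ) - t) ^ 2) ≤ 2 := by
    refine le_trans ?_ (half_sum ((Q.filter (fun t => t ≤ s)).image (fun t => s - t)))
    rw [Finset.sum_image (by
      intro t ht t' ht' h
      simp only [Finset.coe_filter, Set.mem_ofPred_eq] at ht ht'
      simp only at h
      omega)]
    refine Finset.sum_le_sum fun t ht => (gauss_half s t).trans ?_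
    exact mul_le_of_le_one_right (by positivity) (pow_le_one₀ (by norm_num) (by norm_num))
  have h2 : ∑ t ∈ Q.filter (fun t => ¬ t ≤ s), Real.exp (-Real.pi * ((s : ℝ) - t) ^ 2) ≤ 2 := by
    refine le_trans ?_ (half_sum ((Q.filter (fun t => ¬ t ≤ s)).image (fun t => t - s)))
    rw [Finset.sum_image (by
      intro t ht t' ht' h
      simp only [Finset.coe_filter, Set.mem_ofPred_eq] at ht ht'
      simp only at h
      omega)]
    refine Finset.sum_le_sum fun t ht => (gauss_half s t).trans ?_
    exact mul_le_of_le_one_left (by positivity) (pow_le_one₀ (by norm_num) (by norm_num))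
  rw [← Finset.sum_filter_add_sum_filter_not Q (fun t => t ≤ s)]
  linarith

lemma HH_zero_le (D : ℝ) (Q : Finset ℕ) : HH D Q 0 ≤ 4 := by
  unfold HH
  have : ∑ s ∈ Q, ∑ t ∈ Q, Real.exp (-Real.pi * (D * 0 + s - t) ^ 2) ≤ Q.card * 4 := by
    rw [← nsmul_eq_mul]
    apply Finset.sum_le_card_nsmul
    intro s _
    simpa using gauss_row Q s
  calc _ ≤ (Q.card : ℝ)⁻¹ * (Q.card * 4) := by gcongr
    _ ≤ 4 := by
      rcases eq_or_ne (Q.card : ℝ) 0 with h | h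
      · rw [h]; simp
      · rw [inv_mul_cancel_left₀ h]

lemma HH_lower (D : ℝ) (hD : 0 < D) (P Q : Finset ℕ) (hPQ : P ⊆ Q)
    (hadd : ∀ p ∈ P, ∀ p' ∈ P, p + p' ∈ Q) (p : ℕ) (hp : p ∈ P) (x : ℝ)
    (hx : x ∈ Set.Ico ((p : ℝ) / D) (((p : ℝ) + 2) / D)) :
    Real.exp (-4 * Real.pi) * P.card / Q.card ≤ HH D Q x := by
  rw [Set.mem_Ico, div_le_iff₀ hD, lt_div_iff₀ hD] at hx
  have h1 : (P.card : ℝ) * Real.exp (-4 * Real.pi) ≤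
      ∑ s ∈ Q, ∑ t ∈ Q, Real.exp (-Real.pi * (D * x + s - t) ^ 2) := by
    calc (P.card : ℝ) * Real.exp (-4 * Real.pi) = ∑ s ∈ P, Real.exp (-4 * Real.pi) := by simp
      _ ≤ ∑ s ∈ P, ∑ t ∈ Q, Real.exp (-Real.pi * (D * x + s - t) ^ 2) := by
        refine Finset.sum_le_sum fun s hs => ?_
        refine le_trans ?_ (Finset.single_le_sum (f := fun t : ℕ => Real.exp (-Real.pi * (D * x + s - t) ^ 2))
          (fun t _ => by positivity) (hadd s hs p hp))
        show _ ≤ Real.exp _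
        rw [Real.exp_le_exp]
        push_cast
        have e : D * x + s - (s + p) = x * D - p := by ring
        rw [e]
        have : (x * D - p) ^ 2 ≤ 4 := by nlinarith
        nlinarith [Real.pi_pos]
      _ ≤ _ := Finset.sum_le_sum_of_subset_of_nonneg hPQ fun s _ _ =>
        Finset.sum_nonneg fun t _ => by positivity
  unfold HH
  calc _ = (Q.card : ℝ)⁻¹ * ((P.card : ℝ) * Real.exp (-4 * Real.pi)) := by ring
    _ ≤ _ := by gcongr

lemma lq_lower (μ : Measure ℝ) [IsProbabilityMeasure μ] (D : ℝ) (hD : 0 < D) (P Q : Finset ℕ)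
    (hPQ : P ⊆ Q) (hadd : ∀ p ∈ P, ∀ p' ∈ P, p + p' ∈ Q) (F : Set ℝ) (hFm : MeasurableSet F)
    (hF : ∀ x ∈ F, ∃ p ∈ P, x ∈ Set.Ico ((p : ℝ) / D) (((p : ℝ) + 2) / D)) (q : ℝ) (hq : 2 ≤ q) :
    ENNReal.ofReal (Real.exp (-4 * Real.pi) * P.card / Q.card * (μ F).toReal) ≤
      eLpNorm (fun ξ : ℝ => ∫ x in F, ech (ξ * x) ∂μ) (ENNReal.ofReal q) volume *
        ENNReal.ofReal (4 * (Q.card / D) ^ (1 / q)) := by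
  set ν : Measure ℝ := volume.withDensity (fun ξ => ENNReal.ofReal (Hh D Q ξ)) with hν
  have hmeas : Measurable (fun ξ => ENNReal.ofReal (Hh D Q ξ)) :=
    (Hh_continuous D Q).measurable.ennreal_ofReal
  have hνint : ∀ g : ℝ → ℂ, ∫ ξ, g ξ ∂ν = ∫ ξ, (Hh D Q ξ) • g ξ := by
    intro g
    rw [hν, integral_withDensity_eq_integral_toReal_smul hmeas
      (Eventually.of_forall fun _ => ENNReal.ofReal_lt_top)]
    congr 1; ext ξ
    rw [ENNReal.toReal_ofReal (Hh_nonneg D hD Q ξ)]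
  have hνuniv : ν Set.univ ≤ ENNReal.ofReal 4 := by
    rw [hν, withDensity_apply _ MeasurableSet.univ, Measure.restrict_univ,
      ← ofReal_integral_eq_lintegral_ofReal (Hh_integrable D hD Q)
        (Eventually.of_forall (Hh_nonneg D hD Q))]
    apply ENNReal.ofReal_le_ofReal
    have h := HH_eq D hD Q 0
    simp only [mul_zero, ech_zero, Complex.real_smul, mul_one] at h
    rw [integral_complex_ofReal] at h
    rw [Complex.ofReal_inj.1 h]
    exact HH_zero_le D Q
  have : IsFiniteMeasure ν := ⟨hνuniv.trans_lt ENNReal.ofReal_lt_top⟩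
  have hνle : ν ≤ ENNReal.ofReal (Q.card / D) • volume := by
    rw [hν, ← withDensity_const]
    exact withDensity_mono (Eventually.of_forall fun ξ => ENNReal.ofReal_le_ofReal (Hh_le D hD Q ξ))
  set f : ℝ → ℂ := fun ξ => ∫ x in F, ech (ξ * x) ∂μ with hf
  have hfc : Continuous f := by
    have hc := continuous_ech
    refine continuous_of_dominated (bound := fun _ => 1) ?_ ?_ (integrable_const _) ?_
    · intro ξ; exact Continuous.aestronglyMeasurable (by fun_prop)
    · intro ξ; exact Eventually.of_forall fun x => (norm_ech _).le
    · exact Eventually.of_forall fun x => by fun_prop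
  -- duality
  have hswap : ∫ ξ, f ξ ∂ν = ((∫ x in F, HH D Q x ∂μ : ℝ) : ℂ) := by
    have hc := continuous_ech
    rw [hf, integral_integral_swap (μ := ν) (ν := μ.restrict F) (f := fun ξ x => ech (ξ * x))]
    · rw [← integral_complex_ofReal]
      congr 1; ext x
      rw [hνint, HH_eq D hD]
    · refine (integrable_const (1 : ℝ)).mono' (Continuous.aestronglyMeasurable ?_) ?_
      · show Continuous fun p : ℝ × ℝ => ech (p.1 * p.2)
        fun_prop
      · exact Eventually.of_forall fun p => (norm_ech _).le
  have hHHc : Continuous (HH D Q) := by unfold HH; fun_prop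
  have hHHb : ∀ x, HH D Q x ≤ Q.card := by
    intro x
    unfold HH
    calc _ ≤ (Q.card : ℝ)⁻¹ * (∑ s ∈ Q, ∑ t ∈ Q, (1 : ℝ)) := by
          gcongr with s _ t _
          rw [Real.exp_le_one_iff]
          have := Real.pi_pos
          have : 0 ≤ Real.pi * (D * x + s - t) ^ 2 := by positivity
          linarith
      _ ≤ Q.card := by
        simp only [Finset.sum_const, nsmul_eq_mul, mul_one]
        rcases eq_or_ne (Q.card : ℝ) 0 with h | h
        · rw [h]; simp
        · rw [inv_mul_cancel_left₀ h]
  have hHH0 : ∀ x, 0 ≤ HH D Q x := by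
    intro x; unfold HH; positivity
  have hlow : Real.exp (-4 * Real.pi) * P.card / Q.card * (μ F).toReal ≤ ∫ x in F, HH D Q x ∂μ := by
    have h1 := setIntegral_mono_on (μ := μ) (s := F) (f := fun _ => Real.exp (-4 * Real.pi) * P.card / Q.card)
      (g := HH D Q) (integrable_const _) ?_ hFm ?_
    · rw [setIntegral_const, smul_eq_mul, mul_comm] at h1
      exact h1
    · refine (integrable_const (Q.card : ℝ)).mono' hHHc.aestronglyMeasurable ?_
      refine Eventually.of_forall fun x => ?_
      rw [Real.norm_of_nonneg (hHH0 x)]; exact hHHb x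
    · intro x hx
      obtain ⟨p, hp, hxp⟩ := hF x hx
      exact HH_lower D hD P Q hPQ hadd p hp x hxp
  have hq1 : (1 : ENNReal) ≤ ENNReal.ofReal q := by
    rw [← ENNReal.ofReal_one]; exact ENNReal.ofReal_le_ofReal (by linarith)
  have hqr : (ENNReal.ofReal q).toReal = q := ENNReal.toReal_ofReal (by linarith)
  have hexp : (1 / ENNReal.ofReal q).toReal = 1 / q := by
    rw [ENNReal.toReal_div, hqr]; simp
  calc ENNReal.ofReal (Real.exp (-4 * Real.pi) * P.card / Q.card * (μ F).toReal)
      ≤ ENNReal.ofReal (∫ x in F, HH D Q x ∂μ) := ENNReal.ofReal_le_ofReal hlow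
    _ ≤ ‖∫ ξ, f ξ ∂ν‖ₑ := by
        rw [hswap, ← ofReal_norm, Complex.norm_real]
        exact ENNReal.ofReal_le_ofReal (le_abs_self _)
    _ ≤ ∫⁻ ξ, ‖f ξ‖ₑ ∂ν := enorm_integral_le_lintegral_enorm _
    _ = eLpNorm f 1 ν := eLpNorm_one_eq_lintegral_enorm.symm
    _ ≤ eLpNorm f (ENNReal.ofReal q) ν * ν Set.univ ^ (1 / (1 : ENNReal).toReal - 1 / (ENNReal.ofReal q).toReal) :=
        eLpNorm_le_eLpNorm_mul_rpow_measure_univ hq1 hfc.aestronglyMeasurable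
    _ ≤ (ENNReal.ofReal (Q.card / D) ^ (1 / q) * eLpNorm f (ENNReal.ofReal q) volume) * ENNReal.ofReal 4 := by
        gcongr
        · refine (eLpNorm_mono_measure f hνle).trans (le_of_eq ?_)
          rw [eLpNorm_smul_measure_of_ne_top ENNReal.ofReal_ne_top, hexp, smul_eq_mul]
        · rw [hqr, ENNReal.toReal_one, div_one]
          have hqi : 0 < 1 / q := by positivity
          have hqi2 : 1 / q ≤ 1 := by rw [div_le_one (by linarith)]; linarith
          calc ν Set.univ ^ (1 - 1 / q) ≤ ENNReal.ofReal 4 ^ (1 - 1 / q) :=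
                ENNReal.rpow_le_rpow hνuniv (by linarith)
            _ ≤ ENNReal.ofReal 4 ^ (1 : ℝ) := by
                apply ENNReal.rpow_le_rpow_of_exponent_le _ (by linarith)
                rw [← ENNReal.ofReal_one]; exact ENNReal.ofReal_le_ofReal (by norm_num)
            _ = _ := ENNReal.rpow_one _
    _ = _ := by
        rw [ENNReal.ofReal_mul (by norm_num), ENNReal.ofReal_rpow_of_nonneg (by positivity) (by positivity)]
        ring


lemma zero_mem_gap (D : ℕ → Prop) (n : ℕ) : 0 ∈ gap D {0} n := by
  induction n with
  | zero => simp [gap]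
  | succ n ih => rw [mem_gap_succ]; exact Or.inl ⟨0, ih, rfl⟩

lemma zero_mem_Pst (b : ℕ → ℕ) (n : ℕ) : 0 ∈ Pst b n := zero_mem_gap _ n

lemma Pst_sub_Qst (b : ℕ → ℕ) (n : ℕ) : Pst b n ⊆ Qst b n := by
  intro p hp
  have := Pst_add b n p 0 hp (zero_mem_Pst b n)
  simpa using this

/-- the test sets -/
noncomputable def Fst (b : ℕ → ℕ) (l : ℕ) : Set ℝ :=
  ⋃ p ∈ Pst b l, Set.Ico ((p : ℝ) / 2 ^ l) (((p : ℝ) + 2) / 2 ^ l)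

lemma Fst_form (b : ℕ → ℕ) (l : ℕ) : ∃ S : Finset (ℝ × ℝ), Fst b l = ⋃ p ∈ S, Set.Ico p.1 p.2 := by
  classical
  refine ⟨(Pst b l).image (fun p : ℕ => ((p : ℝ) / 2 ^ l, ((p : ℝ) + 2) / 2 ^ l)), ?_⟩
  rw [Finset.set_biUnion_finset_image]
  rfl

lemma Fst_meas (b : ℕ → ℕ) (l : ℕ) : MeasurableSet (Fst b l) :=
  Finset.measurableSet_biUnion _ fun _ _ => measurableSet_Ico

lemma Fst_lower (a b : ℕ → ℕ) (hb0 : b 0 = 0) (hb : ∀ n, b (n + 1) = b n ∨ b (n + 1) = b n + 1)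
    (s : ℕ → ℕ → ℕ) (hP : ∀ n, ∀ p ∈ Pst b n, ∃ k < 2 ^ a n, s n k = p) (μ : Measure ℝ)
    (hlow : ∀ (n : ℕ) (T : Finset ℕ) (A : Set ℝ), MeasurableSet A → T ⊆ Finset.range (2 ^ a n) →
        (∀ k ∈ T, Set.Icc ((s n k : ℝ) / 2 ^ n) (((s n k : ℝ) + 1) / 2 ^ n) ⊆ A) →
        (T.card : ℝ) / 2 ^ a n ≤ (μ A).toReal) (l : ℕ) :
    (2 : ℝ) ^ b l / 2 ^ a l ≤ (μ (Fst b l)).toReal := by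
  classical
  set T := (Finset.range (2 ^ a l)).filter (fun k => s l k ∈ Pst b l) with hT
  have h1 := hlow l T (Fst b l) (Fst_meas b l) (Finset.filter_subset _ _) (by
    intro k hk x hx
    rw [hT, Finset.mem_filter] at hk
    unfold Fst
    simp only [Set.mem_iUnion]
    refine ⟨s l k, hk.2, hx.1, hx.2.trans_lt ?_⟩
    gcongr
    norm_num)
  refine le_trans ?_ h1
  have h2 : (Pst b l).card ≤ T.card := by
    refine le_trans (Finset.card_le_card (t := T.image (s l)) ?_) Finset.card_image_le
    intro p hp
    obtain ⟨k, hk, rfl⟩ := hP l p hp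
    exact Finset.mem_image.2 ⟨k, by rw [hT, Finset.mem_filter, Finset.mem_range]; exact ⟨hk, hp⟩, rfl⟩
  rw [card_Pst b hb0 hb] at h2
  have h3 : ((2 ^ b l : ℕ) : ℝ) ≤ T.card := by exact_mod_cast h2
  push_cast at h3
  gcongr

lemma unbounded (α β : ℝ) (hβ0 : 0 < β) (a b R : ℕ → ℕ) (mm Qc : ℕ → ℝ) (N : ℕ → ENNReal)
    (hm : ∀ l, (2 : ℝ) ^ b l / 2 ^ a l ≤ mm l) (hQ0 : ∀ l, 0 < Qc l)
    (hQ : ∀ l, Qc l ≤ 2 * 2 ^ (b l + R l)) (q : ℝ) (hq : 2 ≤ q) (hq2 : q < 2 + 4 * (1 - α) / β)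
    (hev : ∀ ε : ℝ, 0 < ε → ∀ᶠ l : ℕ in atTop, (a l : ℝ) ≤ (α + ε) * l ∧ (α - β / 2 - ε) * l ≤ b l ∧
      (R l : ℝ) ≤ ε * l)
    (hN : ∀ l, ENNReal.ofReal (Real.exp (-4 * Real.pi) * 2 ^ b l / Qc l * mm l) ≤
      N l * ENNReal.ofReal (4 * (Qc l / 2 ^ l) ^ (1 / q))) (B : ℝ) :
    ∃ l : ℕ, 1 ≤ l ∧ ENNReal.ofReal (B * Real.sqrt (mm l)) < N l := by
  set γ : ℝ := -β / 4 + (1 - α + β / 2) / q with hγ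
  have hq0 : 0 < q := by linarith
  have hγ0 : 0 < γ := by
    have h1 : q * β < 2 * β + 4 * (1 - α) := by
      have : (2 + 4 * (1 - α) / β) * β = 2 * β + 4 * (1 - α) := by field_simp
      rw [← this]; gcongr
    have h2 : β / 4 < (1 - α + β / 2) / q := by
      rw [lt_div_iff₀ hq0]; linarith
    rw [hγ]; linarith
  set K : ℝ := 4 * Real.exp (4 * Real.pi) * (|B| + 1) * 4 with hK
  have hK0 : 0 < K := by positivity
  have hgrow : ∀ᶠ l : ℕ in atTop, K < (2 : ℝ) ^ (γ / 2 * l) := by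
    have h2 : (1 : ℝ) < (2 : ℝ) ^ (γ / 2) := Real.one_lt_rpow (by norm_num) (by linarith)
    filter_upwards [(tendsto_pow_atTop_atTop_of_one_lt h2).eventually_gt_atTop K] with l hl
    rwa [Real.rpow_mul (by norm_num), Real.rpow_natCast]
  obtain ⟨l, ⟨hal, hbl, hRl⟩, hgl, hl1⟩ := ((hev (γ / 6) (by positivity)).and (hgrow.and (eventually_ge_atTop 1))).exists
  refine ⟨l, hl1, ?_⟩
  by_contra hcon
  rw [not_lt] at hcon
  have hmpos : 0 < mm l := lt_of_lt_of_le (by positivity) (hm l)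
  have hQl := hQ0 l
  have h1 := (hN l).trans (mul_le_mul_left hcon _)
  have h2 : ENNReal.ofReal (B * Real.sqrt (mm l)) ≤ ENNReal.ofReal ((|B| + 1) * Real.sqrt (mm l)) := by
    apply ENNReal.ofReal_le_ofReal
    gcongr
    linarith [le_abs_self B]
  have h3 := h1.trans (mul_le_mul_left h2 _)
  rw [← ENNReal.ofReal_mul (by positivity), ENNReal.ofReal_le_ofReal_iff (by positivity)] at h3
  -- h3 : e^{-4π} 2^b / Q * m ≤ (|B|+1) √m * (4 (Q/2^l)^{1/q})
  set σ := Real.sqrt (mm l) with hσ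
  have hσ0 : 0 < σ := Real.sqrt_pos.2 hmpos
  have hσ2 : mm l = σ * σ := (Real.mul_self_sqrt hmpos.le).symm
  set X : ℝ := (Qc l / 2 ^ l) ^ (1 / q) with hX
  have hX0 : 0 < X := by positivity
  have h4 : σ * 2 ^ b l ≤ 4 * Real.exp (4 * Real.pi) * (|B| + 1) * X * Qc l := by
    rw [hσ2] at h3
    have he : Real.exp (-4 * Real.pi) * Real.exp (4 * Real.pi) = 1 := by
      rw [← Real.exp_add]; simp
    have h5 : Real.exp (-4 * Real.pi) * 2 ^ b l * σ * σ ≤ (|B| + 1) * (4 * X) * Qc l * σ := by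
      rw [div_mul_eq_mul_div, div_le_iff₀ hQl] at h3
      nlinarith
    have h6 := le_of_mul_le_mul_right h5 hσ0
    calc σ * 2 ^ b l = (Real.exp (-4 * Real.pi) * Real.exp (4 * Real.pi)) * (σ * 2 ^ b l) := by rw [he, one_mul]
      _ = Real.exp (4 * Real.pi) * (Real.exp (-4 * Real.pi) * 2 ^ b l * σ) := by ring
      _ ≤ Real.exp (4 * Real.pi) * ((|B| + 1) * (4 * X) * Qc l) := by gcongr
      _ = _ := by ring
  have two : (0 : ℝ) < 2 := by norm_num
  have hpow : ∀ n : ℕ, (2 : ℝ) ^ n = (2 : ℝ) ^ (n : ℝ) := fun n => (Real.rpow_natCast 2 n).symm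
  have hσl : (2 : ℝ) ^ (((b l : ℝ) - a l) / 2) ≤ σ := by
    rw [hσ]
    apply Real.le_sqrt_of_sq_le
    refine le_trans (le_of_eq ?_) (hm l)
    rw [hpow, hpow, ← Real.rpow_sub two, ← Real.rpow_natCast, ← Real.rpow_mul two.le]
    congr 1; push_cast; ring
  have hiq : 0 < 1 / q := by positivity
  have hiq2 : 1 / q ≤ 1 / 2 := by gcongr
  have hXl : X ≤ 2 * (2 : ℝ) ^ ((R l : ℝ) + ((b l : ℝ) - l) / q) := by
    calc X ≤ (2 * 2 ^ (b l + R l) / 2 ^ l) ^ (1 / q) := by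
          rw [hX]; gcongr; exact hQ l
      _ = (2 : ℝ) ^ ((1 + (b l + R l) - l) * (1 / q) : ℝ) := by
          rw [← pow_succ', hpow, hpow, ← Real.rpow_sub two, ← Real.rpow_mul two.le]
          congr 1; push_cast; ring
      _ ≤ (2 : ℝ) ^ (1 + ((R l : ℝ) + ((b l : ℝ) - l) / q)) := by
          apply Real.rpow_le_rpow_of_exponent_le (by norm_num)
          have : (0 : ℝ) ≤ R l := Nat.cast_nonneg _
          have e : (1 + ((b l : ℝ) + R l) - l) * (1 / q) = (1 + R l) * (1 / q) + ((b l : ℝ) - l) / q := by ring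
          rw [e]
          nlinarith
      _ = _ := by rw [Real.rpow_add two, Real.rpow_one]
  have hQl2 : Qc l ≤ 2 * ((2 : ℝ) ^ b l * (2 : ℝ) ^ (R l : ℝ)) := by
    have := hQ l
    rw [pow_add] at this
    rwa [← hpow]
  have h7 : (2 : ℝ) ^ (((b l : ℝ) - a l) / 2) ≤ K * ((2 : ℝ) ^ ((R l : ℝ) + ((b l : ℝ) - l) / q) * (2 : ℝ) ^ (R l : ℝ)) := by
    have hb : (0 : ℝ) < 2 ^ b l := by positivity
    refine le_of_mul_le_mul_right ?_ hb
    calc (2 : ℝ) ^ (((b l : ℝ) - a l) / 2) * 2 ^ b l ≤ σ * 2 ^ b l := by gcongr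
      _ ≤ 4 * Real.exp (4 * Real.pi) * (|B| + 1) * X * Qc l := h4
      _ ≤ 4 * Real.exp (4 * Real.pi) * (|B| + 1) * (2 * (2 : ℝ) ^ ((R l : ℝ) + ((b l : ℝ) - l) / q)) *
          (2 * ((2 : ℝ) ^ b l * (2 : ℝ) ^ (R l : ℝ))) := by gcongr
      _ = _ := by rw [hK]; ring
  have h8 : (2 : ℝ) ^ (γ / 2 * l) ≤ K := by
    rw [← Real.rpow_add two] at h7
    have h9 : (2 : ℝ) ^ (((b l : ℝ) - a l) / 2 - ((R l : ℝ) + ((b l : ℝ) - l) / q + R l)) ≤ K := by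
      rw [Real.rpow_sub two, div_le_iff₀ (by positivity)]; exact h7
    refine le_trans (Real.rpow_le_rpow_of_exponent_le (by norm_num) ?_) h9
    have hl0 : (0 : ℝ) ≤ l := Nat.cast_nonneg l
    have e1 : ((b l : ℝ) - a l) / 2 - ((R l : ℝ) + ((b l : ℝ) - l) / q + R l) =
        (b l : ℝ) * (1 / 2 - 1 / q) - a l / 2 + l * (1 / q) - 2 * R l := by ring
    have e2 : (α - β / 2 - γ / 6) * l * (1 / 2 - 1 / q) ≤ (b l : ℝ) * (1 / 2 - 1 / q) :=
      mul_le_mul_of_nonneg_right hbl (by linarith)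
    have e3 : (α - β / 2 - γ / 6) * l * (1 / 2 - 1 / q) - (α + γ / 6) * l / 2 + l * (1 / q) - 2 * (γ / 6 * l)
        = γ * l - (γ / 6 * l) * (3 - 1 / q) := by
      rw [hγ]; ring
    have e4 : 0 ≤ (γ / 6 * l) * (1 / q) := by positivity
    rw [e1]
    nlinarith
  linarith

/-- **Theorem 1, first part (Chen).** Given `0 < β ≤ α < 1` and a nondecreasing function
`φ : [2,∞) → (0,∞)` with `φ(t) → ∞` and `φ(2t) ≤ φ(t) + C₀`, there exist a compact set `E ⊆ ℝ`,
a Borel probability measure `μ` supported on `E`, sets `F_l` (finite unions of intervals, of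
positive `μ`-measure), and constants `0 < c ≤ C` such that: `|μ̂(ξ)| ≤ C |ξ|^{-β/2}` for `ξ ≠ 0`;
`c (2r)^α/(φ(1/(2r)) log(1/(2r))) ≤ μ([x-r,x+r]) ≤ C (2r)^α/log(1/(2r))` for `x ∈ E`,
`0 < r < 1/4`; and for each `2 ≤ q < 2 + 4(1-α)/β` the ratios
`‖(1_{F_l} dμ)^∧‖_{L^q(ℝ)} / ‖1_{F_l}‖_{L²(μ)}` are unbounded in `l`. -/
theorem sharpness_L2_restriction (α β C₀ : ℝ) (hβ0 : 0 < β) (hβα : β ≤ α) (hα1 : α < 1)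
    (φ : ℝ → ℝ) (hφpos : ∀ t : ℝ, 2 ≤ t → 0 < φ t)
    (hφmono : ∀ s t : ℝ, 2 ≤ s → s ≤ t → φ s ≤ φ t)
    (hφtop : Tendsto φ atTop atTop)
    (hφdbl : ∀ t : ℝ, 2 ≤ t → φ (2 * t) ≤ φ t + C₀) :
    ∃ (E : Set ℝ) (μ : Measure ℝ) (F : ℕ → Set ℝ) (c C : ℝ),
      IsCompact E ∧ IsProbabilityMeasure μ ∧ μ E = 1 ∧ 0 < c ∧ c ≤ C ∧
      (∀ l : ℕ, 1 ≤ l →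
        (∃ S : Finset (ℝ × ℝ), F l = ⋃ p ∈ S, Set.Ico p.1 p.2) ∧ 0 < μ (F l)) ∧
      (∀ ξ : ℝ, ξ ≠ 0 →
        ‖∫ x : ℝ, Complex.exp (-(2 * (Real.pi : ℂ) * Complex.I * (ξ : ℂ) * (x : ℂ))) ∂μ‖
          ≤ C * |ξ| ^ (-(β / 2))) ∧
      (∀ x ∈ E, ∀ r : ℝ, 0 < r → r < 1 / 4 →
        c * (2 * r) ^ α / (φ (1 / (2 * r)) * Real.log (1 / (2 * r)))
            ≤ (μ (Set.Icc (x - r) (x + r))).toReal ∧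
        (μ (Set.Icc (x - r) (x + r))).toReal ≤ C * (2 * r) ^ α / Real.log (1 / (2 * r))) ∧
      (∀ q : ℝ, 2 ≤ q → q < 2 + 4 * (1 - α) / β →
        ∀ B : ℝ, ∃ l : ℕ, 1 ≤ l ∧
          ENNReal.ofReal (B * Real.sqrt ((μ (F l)).toReal)) <
            eLpNorm (fun ξ : ℝ => ∫ x in F l,
                Complex.exp (-(2 * (Real.pi : ℂ) * Complex.I * (ξ : ℂ) * (x : ℂ))) ∂μ)
              (ENNReal.ofReal q) volume) := by
  obtain ⟨a, b, C1, hC1, ha0, hb0, ha, hb, hba, h1, h2, h3, hev⟩ :=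
    seqs α β hβ0 hβα hα1 φ hφpos hφmono hφtop
  obtain ⟨s, e, hs0, hs1, hs2, he, hinj, hP, hB⟩ := tree_exists a b ha0 hb0 ha hb hba
  obtain ⟨E, μ, hEc, hprob, hμE, hEcell, hlow, hup, hlim⟩ := measure_exists a s e ha hs1 hs2 he
  obtain ⟨C2, hC2, hdec⟩ := decay α β C1 hβ0 hβα hα1 hC1 a b s e ha0 hs0 ha hs1 hs2 he h1 h3 hB μ hlim
  have hconv : ∀ ξ x : ℝ, Complex.exp (-(2 * (Real.pi : ℂ) * Complex.I * (ξ : ℂ) * (x : ℂ))) =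
      ech (ξ * x) := by
    intro ξ x
    rw [ech]
    push_cast
    congr 1
    ring
  have hball := ball_bounds α C1 (by linarith) hα1 hC1 φ hφpos hφmono a s h1 h2 hinj E μ hEcell hlow hup
  have hFl := Fst_lower a b hb0 hb s hP μ hlow
  simp only [hconv]
  set c0 : ℝ := 1 / (32 * C1) with hc0
  have hc0pos : 0 < c0 := by positivity
  refine ⟨E, μ, Fst b, c0, 6 * C1 + C2 + c0, hEc, hprob, hμE, hc0pos, by linarith, ?_, ?_, ?_, ?_⟩
  · intro l _
    refine ⟨Fst_form b l, ?_⟩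
    have : 0 < (μ (Fst b l)).toReal := lt_of_lt_of_le (by positivity) (hFl l)
    exact (ENNReal.toReal_pos_iff.1 this).1
  · intro ξ hξ
    refine (hdec ξ hξ).trans ?_
    gcongr
    linarith
  · intro x hx r hr0 hr
    obtain ⟨g1, g2⟩ := hball x hx r hr0 hr
    refine ⟨g1, g2.trans ?_⟩
    have hlog : 0 ≤ Real.log (1 / (2 * r)) := by
      apply Real.log_nonneg
      rw [le_div_iff₀ (by positivity)]
      linarith
    gcongr
    linarith
  · intro q hq hq2 B
    refine unbounded α β hβ0 a b (fun n => ((Finset.range n).filter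
      (fun j => b (j + 1) = b j ∧ b (j + 1 + 1) ≠ b (j + 1))).card)
      (fun l => (μ (Fst b l)).toReal) (fun l => ((Qst b l).card : ℝ))
      (fun l => eLpNorm (fun ξ : ℝ => ∫ x in Fst b l, ech (ξ * x) ∂μ) (ENNReal.ofReal q) volume)
      hFl ?_ ?_ q hq hq2 hev ?_ B
    · intro l
      have := (card_Qst b hb0 hb l).1
      have h5 : 0 < (Qst b l).card := lt_of_lt_of_le (by positivity) this
      exact_mod_cast h5
    · intro l
      exact_mod_cast (card_Qst b hb0 hb l).2
    · intro l
      have h5 := lq_lower μ (2 ^ l) (by positivity) (Pst b l) (Qst b l) (Pst_sub_Qst b l)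
        (fun p hp p' hp' => Pst_add b l p p' hp hp') (Fst b l) (Fst_meas b l) (by
          intro x hx
          unfold Fst at hx
          simp only [Set.mem_iUnion] at hx
          obtain ⟨p, hp, hxp⟩ := hx
          exact ⟨p, hp, hxp⟩) q hq
      rw [card_Pst b hb0 hb] at h5
      push_cast at h5
      exact h5
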